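/- arXiv:1704.07253 — 2 statements merged into one kernel-verified Lean document; each statement's English description precedes it below -/
import Mathlib

section
/- Let A ⊂ ℝ² be a nonempty compact simply connected set with reach(A) > 0. Then the outer Minkowski content M_o(A) = lim_{r→0⁺} (|A_r| − |A|)/r exists, and for every 0 < r < reach(A) the Steiner formulas hold: |A_r| = |A| + M_o(A)·r + π r² and P(A_r) = M_o(A) + 2π r, where P(A_r) is the perimeter of the parallel set A_r. -/
open MeasureTheory Metric Set ENNReal

/-- Divergence of a vector field on `ℝ²`. -/
noncomputable def vdiv (φ : EuclideanSpace ℝ (Fin 2) → EuclideanSpace ℝ (Fin 2))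
    (x : EuclideanSpace ℝ (Fin 2)) : ℝ :=
  ∑ i : Fin 2, fderiv ℝ φ x (EuclideanSpace.single i 1) i

/-- Relative (distributional) perimeter of `E` in the open set `A`. -/
noncomputable def perimeterIn (E A : Set (EuclideanSpace ℝ (Fin 2))) : ℝ≥0∞ :=
  ⨆ (φ : EuclideanSpace ℝ (Fin 2) → EuclideanSpace ℝ (Fin 2)) (_ : ContDiff ℝ 1 φ)
    (_ : HasCompactSupport φ) (_ : tsupport φ ⊆ A) (_ : ∀ x, ‖φ x‖ ≤ 1),
    ENNReal.ofReal (∫ x in E, vdiv φ x)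

noncomputable def perimeter (E : Set (EuclideanSpace ℝ (Fin 2))) : ℝ≥0∞ :=
  perimeterIn E Set.univ

/-- The parallel set `A_r = {x : dist(x,A) ≤ r}`. -/
def parSet (A : Set (EuclideanSpace ℝ (Fin 2))) (r : ℝ) : Set (EuclideanSpace ℝ (Fin 2)) :=
  {x | Metric.infDist x A ≤ r}

/-- The reach of `A`: the supremum of the `r` such that every point at distance at most `r`
from `A` has a unique nearest point in `A`. -/
noncomputable def reach (A : Set (EuclideanSpace ℝ (Fin 2))) : ℝ≥0∞ :=
  sSup {r : ℝ≥0∞ | ∀ x : EuclideanSpace ℝ (Fin 2), EMetric.infEdist x A ≤ r →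
    ∃! y, y ∈ A ∧ dist x y = Metric.infDist x A}

open scoped NNReal Topology

local notation "E2" => EuclideanSpace ℝ (Fin 2)

/-- trace of an endomorphism of the plane, in coordinates -/
noncomputable def tr2 (L : E2 →L[ℝ] E2) : ℝ := ∑ i : Fin 2, L (EuclideanSpace.single i 1) i

/-- determinant of an endomorphism of the plane, in coordinates -/
noncomputable def det2 (L : E2 →L[ℝ] E2) : ℝ :=
  L (EuclideanSpace.single 0 1) 0 * L (EuclideanSpace.single 1 1) 1
    - L (EuclideanSpace.single 1 1) 0 * L (EuclideanSpace.single 0 1) 1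

lemma det2_eq (L : E2 →L[ℝ] E2) : L.det = det2 L := by
  have := LinearMap.det_toMatrix (EuclideanSpace.basisFun (Fin 2) ℝ).toBasis (L : E2 →ₗ[ℝ] E2)
  unfold ContinuousLinearMap.det
  rw [← this, Matrix.det_fin_two]
  simp [LinearMap.toMatrix_apply, det2]

lemma det_one_add (L : E2 →L[ℝ] E2) (t : ℝ) :
    (ContinuousLinearMap.id ℝ E2 + t • L).det = 1 + t * tr2 L + t ^ 2 * det2 L := by
  rw [det2_eq]
  simp [det2, tr2, Fin.sum_univ_two]
  ring

lemma abs_coord_le (L : E2 →L[ℝ] E2) (i j : Fin 2) : |L (EuclideanSpace.single i 1) j| ≤ ‖L‖ := by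
  have h1 := L.le_opNorm (EuclideanSpace.single i 1)
  have h2 := PiLp.norm_apply_le (L (EuclideanSpace.single i 1)) j
  simp at h1
  exact le_trans h2 h1

lemma abs_tr2_le (L : E2 →L[ℝ] E2) : |tr2 L| ≤ 2 * ‖L‖ := by
  have h0 := abs_coord_le L 0 0
  have h1 := abs_coord_le L 1 1
  simp only [tr2, Fin.sum_univ_two]
  refine (abs_add_le _ _).trans ?_
  linarith

lemma abs_det2_le (L : E2 →L[ℝ] E2) : |det2 L| ≤ 2 * ‖L‖ ^ 2 := by
  have h0 := abs_coord_le L 0 0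
  have h1 := abs_coord_le L 1 1
  have h2 := abs_coord_le L 1 0
  have h3 := abs_coord_le L 0 1
  unfold det2
  calc _ ≤ _ := abs_sub _ _
    _ ≤ ‖L‖ * ‖L‖ + ‖L‖ * ‖L‖ := by rw [abs_mul, abs_mul]; gcongr
    _ = _ := by ring

lemma continuous_tr2 : Continuous tr2 := by unfold tr2; fun_prop
lemma continuous_det2 : Continuous det2 := by unfold det2; fun_prop

/-- determinant stays positive along a path of invertibles -/
lemma det_pos_of_path (L : E2 →L[ℝ] E2) (t : ℝ)
    (h : ∀ τ ∈ uIcc 0 t, ∀ v, v + τ • L v = 0 → v = 0) :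
    0 < (ContinuousLinearMap.id ℝ E2 + t • L).det := by
  have hne : ∀ τ ∈ uIcc 0 t, (ContinuousLinearMap.id ℝ E2 + τ • L).det ≠ 0 := by
    intro τ hτ h0
    have := LinearMap.bot_lt_ker_of_det_eq_zero (f := ((ContinuousLinearMap.id ℝ E2 + τ • L : E2 →L[ℝ] E2) : E2 →ₗ[ℝ] E2)) h0
    obtain ⟨v, hv, hv0⟩ := (Submodule.ne_bot_iff _).1 this.ne'
    apply hv0
    apply h τ hτ
    simpa using hv
  by_contra hcon
  push Not at hcon
  have hc : ContinuousOn (fun τ : ℝ => (ContinuousLinearMap.id ℝ E2 + τ • L).det) (uIcc 0 t) := by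
    simp only [det_one_add]; fun_prop
  have := intermediate_value_uIcc hc
  have h0 : (0:ℝ) ∈ uIcc ((ContinuousLinearMap.id ℝ E2 + (0:ℝ) • L).det) ((ContinuousLinearMap.id ℝ E2 + t • L).det) := by
    rw [mem_uIcc]; right
    refine ⟨hcon, ?_⟩
    rw [det_one_add]; simp
  obtain ⟨τ, hτ, h1⟩ := this h0
  exact hne τ hτ h1

lemma null_image {f : E2 → E2} {S : Set E2} {K : ℝ≥0} (hf : LipschitzOnWith K f S)
    (h : volume S = 0) : volume (f '' S) = 0 := by
  rw [← EuclideanSpace.euclideanHausdorffMeasure_eq_volume] at h ⊢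
  rw [MeasureTheory.Measure.euclideanHausdorffMeasure_def] at h ⊢
  have hc : (Measure.addHaarScalarFactor (volume : Measure E2) (μH[(2:ℕ)] : Measure E2)) ≠ 0 := by
    intro h0
    have h1 := EuclideanSpace.euclideanHausdorffMeasure_eq_volume 2
    rw [MeasureTheory.Measure.euclideanHausdorffMeasure_def, h0] at h1
    simp at h1
    have := (isOpen_univ (X := E2)).measure_pos volume ⟨0, trivial⟩
    rw [← h1] at this; simp at this
  simp only [Measure.smul_apply, smul_eq_zero] at h ⊢
  have h' : (μH[(2:ℕ)] : Measure E2) S = 0 := by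
    rcases h with h | h
    · exact absurd h hc
    · exact h
  right
  have := hf.hausdorffMeasure_image_le (d := ((2:ℕ):ℝ)) (by simp)
  rw [h', mul_zero] at this
  exact le_antisymm this bot_le

lemma ae_diffAt {Φ : E2 → E2} {U : Set E2} {K : ℝ≥0} (hU : IsOpen U) (hΦ : LipschitzOnWith K Φ U) :
    ∀ᵐ x ∂(volume : Measure E2), x ∈ U → DifferentiableAt ℝ Φ x := by
  filter_upwards [hΦ.ae_differentiableWithinAt_of_mem (μ := volume)] with x hx hxU
  exact (hx hxU).differentiableAt (hU.mem_nhds hxU)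

lemma integrableOn_tr {Φ : E2 → E2} {U S : Set E2} {K : ℝ≥0} (hU : IsOpen U)
    (hΦ : LipschitzOnWith K Φ U) (hS : MeasurableSet S) (hSU : S ⊆ U) (hv : volume S ≠ ∞) :
    IntegrableOn (fun x => tr2 (fderiv ℝ Φ x)) S := by
  refine Measure.integrableOn_of_bounded (M := 2 * K) hv
    (continuous_tr2.measurable.comp (measurable_fderiv ℝ Φ)).aestronglyMeasurable ?_
  filter_upwards [ae_restrict_mem hS] with x hx
  have := norm_fderiv_le_of_lipschitzOn ℝ (hU.mem_nhds (hSU hx)) hΦ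
  have h2 := abs_tr2_le (fderiv ℝ Φ x)
  rw [Real.norm_eq_abs]; linarith

lemma integrableOn_det {Φ : E2 → E2} {U S : Set E2} {K : ℝ≥0} (hU : IsOpen U)
    (hΦ : LipschitzOnWith K Φ U) (hS : MeasurableSet S) (hSU : S ⊆ U) (hv : volume S ≠ ∞) :
    IntegrableOn (fun x => det2 (fderiv ℝ Φ x)) S := by
  refine Measure.integrableOn_of_bounded (M := 2 * K ^ 2) hv
    (continuous_det2.measurable.comp (measurable_fderiv ℝ Φ)).aestronglyMeasurable ?_
  filter_upwards [ae_restrict_mem hS] with x hx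
  have := norm_fderiv_le_of_lipschitzOn ℝ (hU.mem_nhds (hSU hx)) hΦ
  have h2 := abs_det2_le (fderiv ℝ Φ x)
  rw [Real.norm_eq_abs]
  refine h2.trans ?_
  gcongr

/-- If `x ↦ x + τ Φ x` is expanding-up-to-a-constant on an open set then its derivative is
injective there. -/
lemma inj_deriv {Φ : E2 → E2} {U : Set E2} (hU : IsOpen U) {τ k : ℝ}
    (h : ∀ x ∈ U, ∀ y ∈ U, ‖x - y‖ ≤ k * ‖(x + τ • Φ x) - (y + τ • Φ y)‖)
    {x : E2} (hx : x ∈ U) (hd : DifferentiableAt ℝ Φ x) (v : E2)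
    (hv : v + τ • fderiv ℝ Φ x v = 0) : v = 0 := by
  have hT : HasFDerivAt (fun y => y + τ • Φ y) (ContinuousLinearMap.id ℝ E2 + τ • fderiv ℝ Φ x) x :=
    (hasFDerivAt_id x).add (hd.hasFDerivAt.const_smul τ)
  have hl : HasDerivAt (fun s : ℝ => (x + s • v) + τ • Φ (x + s • v)) 0 0 := by
    have h1 : HasDerivAt (fun s : ℝ => x + s • v) v 0 := by
      simpa using ((hasDerivAt_id (0:ℝ)).smul_const v).const_add x
    have := (HasFDerivAt.comp_hasDerivAt (0:ℝ) (f := fun s : ℝ => x + s • v) (l := fun y => y + τ • Φ y)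
      (by simpa using hT) h1)
    simpa [hv, Function.comp_def] using this
  by_contra hv0
  have hpos : 0 < ‖v‖ := norm_pos_iff.2 hv0
  have hev : ∀ᶠ s in 𝓝 (0:ℝ), x + s • v ∈ U := by
    have : ContinuousAt (fun s : ℝ => x + s • v) 0 := by fun_prop
    exact this (hU.mem_nhds (by simpa using hx))
  have hO := hl.isLittleO
  set c : ℝ := 1 / (|k| + 1) with hc
  have hk : 0 < |k| + 1 := by positivity
  have hb := hO.def (c := c / 2 * ‖v‖) (by positivity)
  have hmem := (hev.and hb)
  obtain ⟨s, ⟨hsU, hs⟩, hs0⟩ := ((hmem.filter_mono nhdsWithin_le_nhds).and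
    (self_mem_nhdsWithin : Ioi (0:ℝ) ∈ 𝓝[>] (0:ℝ))).exists
  have hs0' : 0 < s := hs0
  have h2 := h _ hsU _ hx
  simp at hs
  have e : ‖x + s • v + τ • Φ (x + s • v) - (x + τ • Φ x)‖ ≤ c / 2 * ‖v‖ * |s| := hs
  have e2 : ‖x + s • v - x‖ = s * ‖v‖ := by
    rw [add_sub_cancel_left, norm_smul, Real.norm_eq_abs, abs_of_pos hs0']
  rw [e2] at h2
  rw [abs_of_pos hs0'] at e
  have e3 : s * ‖v‖ ≤ (|k| + 1) * (c / 2 * ‖v‖ * s) := by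
    refine h2.trans ?_
    refine mul_le_mul ?_ e (norm_nonneg _) hk.le
    linarith [le_abs_self k]
  have e4 : (|k| + 1) * (c / 2 * ‖v‖ * s) = s * ‖v‖ / 2 := by
    rw [hc]; field_simp
  rw [e4] at e3
  have : 0 < s * ‖v‖ := by positivity
  linarith

/-- Area formula for Lipschitz perturbations of the identity: polynomial dependence on `t`. -/
lemma area_poly {Φ : E2 → E2} {U S : Set E2} {K : ℝ≥0} (hU : IsOpen U)
    (hΦ : LipschitzOnWith K Φ U) (hS : MeasurableSet S) (hSU : S ⊆ U) (hv : volume S ≠ ∞)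
    (t : ℝ)
    (h : ∀ τ ∈ uIcc 0 t, ∃ k : ℝ, ∀ x ∈ U, ∀ y ∈ U,
      ‖x - y‖ ≤ k * ‖(x + τ • Φ x) - (y + τ • Φ y)‖) :
    (volume ((fun x => x + t • Φ x) '' S)).toReal =
      (volume S).toReal + t * (∫ x in S, tr2 (fderiv ℝ Φ x)) +
        t ^ 2 * ∫ x in S, det2 (fderiv ℝ Φ x) := by
  set T : E2 → E2 := fun x => x + t • Φ x with hT
  have hinj : InjOn T U := by
    intro x hx y hy hxy
    obtain ⟨k, hk⟩ := h t right_mem_uIcc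
    have := hk x hx y hy
    have h0 : (x + t • Φ x) - (y + t • Φ y) = 0 := sub_eq_zero.2 hxy
    rw [h0, norm_zero, mul_zero] at this
    exact sub_eq_zero.1 (norm_le_zero_iff.1 this)
  set S' : Set E2 := S ∩ {x | DifferentiableAt ℝ Φ x} with hS'
  have hS'm : MeasurableSet S' := hS.inter (measurableSet_of_differentiableAt ℝ Φ)
  have hnull : volume (S \ S') = 0 := by
    have := ae_diffAt hU hΦ
    rw [ae_iff] at this
    refine measure_mono_null ?_ this
    rintro x ⟨hx, hx'⟩
    simp only [mem_ofPred_eq, Classical.not_imp]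
    exact ⟨hSU hx, fun hd => hx' ⟨hx, hd⟩⟩
  have hTlip : LipschitzOnWith (1 + ‖t‖₊ * K) T U := by
    have := (LipschitzWith.id.lipschitzOnWith (s := U) : LipschitzOnWith 1 (id : E2 → E2) U).add
      ((lipschitzWith_smul t).comp_lipschitzOnWith hΦ)
    exact this
  have hae : S' =ᵐ[volume] S := by
    refine ((ae_le_set.2 ?_)).antisymm (ae_le_set.2 hnull)
    rw [sdiff_eq_empty.2 inter_subset_left]; simp
  have himg : volume (T '' S) = volume (T '' S') := by
    apply le_antisymm _ (measure_mono (image_mono inter_subset_left))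
    have : S = S' ∪ (S \ S') := by rw [union_sdiff_cancel inter_subset_left]
    rw [this, image_union]
    refine (measure_union_le _ _).trans ?_
    rw [null_image (hTlip.mono (sdiff_subset.trans hSU)) hnull, ← this, add_zero]
  rw [himg]
  have hder : ∀ x ∈ S', HasFDerivWithinAt T (ContinuousLinearMap.id ℝ E2 + t • fderiv ℝ Φ x) S' x :=
    fun x hx => ((hasFDerivAt_id x).add (hx.2.hasFDerivAt.const_smul t)).hasFDerivWithinAt
  rw [← lintegral_abs_det_fderiv_eq_addHaar_image volume hS'm hder (hinj.mono (inter_subset_left.trans hSU))]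
  have hvS' : volume S' ≠ ∞ := ne_top_of_le_ne_top hv (measure_mono inter_subset_left)
  have i1 := integrableOn_tr hU hΦ hS hSU hv
  have i2 := integrableOn_det hU hΦ hS hSU hv
  have ic : IntegrableOn (fun _ : E2 => (1:ℝ)) S := integrableOn_const hv
  have hpos : ∀ x ∈ S', |(ContinuousLinearMap.id ℝ E2 + t • fderiv ℝ Φ x).det| =
      1 + t * tr2 (fderiv ℝ Φ x) + t ^ 2 * det2 (fderiv ℝ Φ x) := by
    intro x hx
    rw [← det_one_add, abs_of_pos]
    apply det_pos_of_path
    intro τ hτ v hv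
    obtain ⟨k, hk⟩ := h τ hτ
    exact inj_deriv hU hk (hSU hx.1) hx.2 v hv
  have e1 : ∫⁻ x in S', ENNReal.ofReal |(ContinuousLinearMap.id ℝ E2 + t • fderiv ℝ Φ x).det| =
      ∫⁻ x in S', ENNReal.ofReal (1 + t * tr2 (fderiv ℝ Φ x) + t ^ 2 * det2 (fderiv ℝ Φ x)) :=
    setLIntegral_congr_fun hS'm (fun x hx => by simp only [hpos x hx])
  rw [e1, ← integral_eq_lintegral_of_nonneg_ae]
  · rw [setIntegral_congr_set hae]
    have a1 : IntegrableOn (fun x => 1 + t * tr2 (fderiv ℝ Φ x)) S := ic.add (i1.const_mul t)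
    rw [integral_add a1 (i2.const_mul _),
      integral_add ic (i1.const_mul t), integral_const_mul, integral_const_mul]
    simp [Measure.real]
  · filter_upwards [ae_restrict_mem hS'm] with x hx
    rw [← hpos x hx]; exact abs_nonneg _
  · have a1 : IntegrableOn (fun x => 1 + t * tr2 (fderiv ℝ Φ x)) S := ic.add (i1.const_mul t)
    exact ((a1.add (i2.const_mul _)).mono_set inter_subset_left).aestronglyMeasurable

/-- antilipschitz estimate for small perturbations -/
lemma small_anti {Φ : E2 → E2} {K : ℝ≥0} (hΦ : LipschitzWith K Φ) {τ : ℝ} (ht : |τ| * K < 1)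
    (x y : E2) : ‖x - y‖ ≤ (1 - |τ| * K)⁻¹ * ‖(x + τ • Φ x) - (y + τ • Φ y)‖ := by
  rw [le_inv_mul_iff₀ (by linarith)]
  have h1 := hΦ.dist_le_mul x y
  rw [dist_eq_norm, dist_eq_norm] at h1
  have h2 : x - y = ((x + τ • Φ x) - (y + τ • Φ y)) - τ • (Φ x - Φ y) := by
    rw [smul_sub]; abel
  have h3 : ‖x - y‖ ≤ ‖(x + τ • Φ x) - (y + τ • Φ y)‖ + |τ| * (K * ‖x - y‖) := by
    conv_lhs => rw [h2]
    refine (norm_sub_le _ _).trans ?_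
    rw [norm_smul, Real.norm_eq_abs]
    gcongr
  nlinarith

lemma area_small {Φ : E2 → E2} {K : ℝ≥0} (hΦ : LipschitzWith K Φ) {S : Set E2}
    (hS : MeasurableSet S) (hv : volume S ≠ ∞) {t : ℝ} (ht : |t| * K < 1) :
    (volume ((fun x => x + t • Φ x) '' S)).toReal =
      (volume S).toReal + t * (∫ x in S, tr2 (fderiv ℝ Φ x)) +
        t ^ 2 * ∫ x in S, det2 (fderiv ℝ Φ x) := by
  refine area_poly isOpen_univ hΦ.lipschitzOnWith hS (subset_univ _) hv t ?_
  intro τ hτ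
  refine ⟨(1 - |τ| * K)⁻¹, fun x _ y _ => small_anti hΦ ?_ x y⟩
  have : |τ| ≤ |t| := by
    have := abs_sub_left_of_mem_uIcc hτ
    simpa using this
  refine lt_of_le_of_lt ?_ ht
  gcongr

lemma small_surj {Φ : E2 → E2} {K : ℝ≥0} (hΦ : LipschitzWith K Φ) {t : ℝ} (ht : |t| * K < 1) :
    Function.Surjective (fun x => x + t • Φ x) := by
  intro y
  have hc : ContractingWith (‖t‖₊ * K) (fun x => y - t • Φ x) := by
    refine ⟨?_, ?_⟩
    · rw [← NNReal.coe_lt_coe]; simpa using ht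
    · refine LipschitzWith.of_dist_le_mul fun a b => ?_
      rw [dist_sub_left, dist_smul₀]
      have := hΦ.dist_le_mul a b
      simp only [NNReal.coe_mul, coe_nnnorm]
      rw [mul_assoc]
      gcongr
  refine ⟨hc.fixedPoint, ?_⟩
  have := hc.fixedPoint_isFixedPt
  have h2 : y - t • Φ (hc.fixedPoint) = hc.fixedPoint := this
  show hc.fixedPoint + t • Φ (hc.fixedPoint) = y
  conv_lhs => enter [1]; rw [← h2]
  abel

lemma small_inj {Φ : E2 → E2} {K : ℝ≥0} (hΦ : LipschitzWith K Φ) {t : ℝ} (ht : |t| * K < 1) :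
    Function.Injective (fun x => x + t • Φ x) := by
  intro x y hxy
  have := small_anti hΦ ht x y
  have h0 : (x + t • Φ x) - (y + t • Φ y) = 0 := sub_eq_zero.2 hxy
  rw [h0, norm_zero, mul_zero] at this
  exact sub_eq_zero.1 (norm_le_zero_iff.1 this)

/-- The Jacobian determinant is a null Lagrangian. -/
lemma null_lagrangian {Φ : E2 → E2} {K : ℝ≥0} (hΦ : LipschitzWith K Φ) {B : Set E2}
    (hB : MeasurableSet B) (hv : volume B ≠ ∞) (hsupp : ∀ x ∉ B, Φ x = 0) :
    ∫ x in B, det2 (fderiv ℝ Φ x) = 0 := by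
  have key : ∀ t : ℝ, |t| * K < 1 → t * (∫ x in B, tr2 (fderiv ℝ Φ x)) +
        t ^ 2 * ∫ x in B, det2 (fderiv ℝ Φ x) = 0 := by
    intro t ht
    have h1 := area_small hΦ hB hv ht
    have h2 : (fun x => x + t • Φ x) '' B = B := by
      have hid : ∀ x ∉ B, x + t • Φ x = x := fun x hx => by rw [hsupp x hx]; simp
      apply Subset.antisymm
      · rintro _ ⟨x, hx, rfl⟩
        by_contra hc
        have := small_inj hΦ ht (hid _ hc)
        simp only at this hc
        rw [this] at hc
        exact hc hx
      · intro y hy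
        obtain ⟨x, hx⟩ := small_surj hΦ ht y
        refine ⟨x, ?_, hx⟩
        by_contra hc
        have := hid x hc
        simp only at hx
        rw [this] at hx
        exact hc (hx ▸ hy)
    rw [h2] at h1
    linarith
  set τ : ℝ := 1 / (K + 1) with hτ
  have hK : (0:ℝ) < K + 1 := by positivity
  have hpos : 0 < τ := by positivity
  have hlt : |τ| * K < 1 := by
    rw [abs_of_pos hpos, hτ, div_mul_eq_mul_div, one_mul, div_lt_one hK]; linarith
  have h1 := key τ hlt
  have h2 := key (-τ) (by rw [abs_neg]; exact hlt)
  have : τ ^ 2 * ∫ x in B, det2 (fderiv ℝ Φ x) = 0 := by nlinarith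
  rcases mul_eq_zero.1 this with h | h
  · exact absurd h (by positivity)
  · exact h

/-- uniqueness of nearest points in the open `R`-neighbourhood -/
def UNear (A : Set E2) (R : ℝ) : Prop :=
  ∀ x, infDist x A < R → ∀ y ∈ A, ∀ z ∈ A, dist x y = infDist x A → dist x z = infDist x A → y = z

open Classical in
/-- a nearest point -/
noncomputable def npt (A : Set E2) (x : E2) : E2 :=
  if h : ∃ y ∈ A, infDist x A = dist x y then h.choose else 0

section dist

lemma npt_spec {A : Set E2} (hne : A.Nonempty) (hc : IsCompact A)
    (x : E2) : npt A x ∈ A ∧ infDist x A = dist x (npt A x) := by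
  have h := hc.exists_infDist_eq_dist hne x
  unfold npt
  rw [dif_pos h]
  exact h.choose_spec

lemma npt_mem {A : Set E2} (hne : A.Nonempty) (hc : IsCompact A)
    (x : E2) : npt A x ∈ A := (npt_spec hne hc x).1

lemma norm_sub_npt {A : Set E2} (hne : A.Nonempty) (hc : IsCompact A)
    (x : E2) : ‖x - npt A x‖ = infDist x A := by
  rw [(npt_spec hne hc x).2, dist_eq_norm]

lemma infDist_le_norm {A : Set E2} (hne : A.Nonempty) (hc : IsCompact A)
    {x y : E2} (hy : y ∈ A) : infDist x A ≤ ‖x - y‖ := by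
  rw [← dist_eq_norm]; exact infDist_le_dist_of_mem hy


lemma eq_npt {A : Set E2} (hne : A.Nonempty) (hc : IsCompact A) {R : ℝ} (hU : UNear A R)
    {x y : E2} (hx : infDist x A < R) (hy : y ∈ A) (h : ‖x - y‖ ≤ infDist x A) :
    npt A x = y := by
  refine hU x hx _ (npt_mem hne hc x) y hy (npt_spec hne hc x).2.symm ?_
  exact le_antisymm (by rw [dist_eq_norm]; exact h) (infDist_le_dist_of_mem hy)

lemma npt_continuousAt {A : Set E2} (hne : A.Nonempty) (hc : IsCompact A) {R : ℝ} (hU : UNear A R)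
    {x : E2} (hx : infDist x A < R) : ContinuousAt (npt A) x := by
  refine hc.tendsto_nhds_of_unique_mapClusterPt (Filter.Eventually.of_forall fun y => npt_mem hne hc y) ?_
  intro b hb hcl
  symm
  refine eq_npt hne hc hU hx hb ?_
  refine le_of_forall_pos_le_add fun ε hε => ?_
  have hf := hcl.frequently (ball_mem_nhds b (by positivity : 0 < ε / 3))
  obtain ⟨y, hy1, hy2⟩ := (hf.and_eventually (ball_mem_nhds x (by positivity : 0 < ε / 3))).exists
  have h1 : infDist y A ≤ infDist x A + dist y x := infDist_le_infDist_add_dist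
  have h2 := (npt_spec hne hc y).2
  have h3 := dist_triangle4 x y (npt A y) b
  rw [dist_comm x y] at h3
  rw [← dist_eq_norm]
  linarith

/-- steepest ascent of the distance function -/
lemma ascent_aux {A : Set E2} (hne : A.Nonempty) (hc : IsCompact A) {R : ℝ} (hU : UNear A R)
    {x : E2} (hx0 : 0 < infDist x A) {h : ℝ} (hh : 0 < h) (hxR : infDist x A + h < R) :
    ∃ y, ‖y - x‖ ≤ h ∧ infDist x A + h ≤ infDist y A := by
  obtain ⟨ys, hys, hmax⟩ := (isCompact_closedBall x h).exists_isMaxOn ⟨x, mem_closedBall_self hh.le⟩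
    (continuous_infDist_pt A).continuousOn
  refine ⟨ys, by simpa [dist_eq_norm] using hys, ?_⟩
  by_contra hcon
  push Not at hcon
  obtain ⟨ε, hε0, hε1, hε⟩ : ∃ ε : ℝ, 0 < ε ∧ ε < 1 ∧ infDist ys A < infDist x A + (1 - ε) * h := by
    have hx1 : infDist x A ≤ infDist ys A := hmax (mem_closedBall_self hh.le)
    refine ⟨(infDist x A + h - infDist ys A) / (2 * h), by apply div_pos <;> linarith, ?_, ?_⟩
    · rw [div_lt_one (by linarith)]; linarith
    · have : (infDist x A + h - infDist ys A) / (2 * h) * h = (infDist x A + h - infDist ys A) / 2 := by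
        field_simp
      linarith
  obtain ⟨y, hy, hymax⟩ := (isCompact_closedBall x h).exists_isMaxOn ⟨x, mem_closedBall_self hh.le⟩
    (f := fun y => infDist y A - (1 - ε) * ‖y - x‖)
    ((continuous_infDist_pt A).sub (by fun_prop)).continuousOn
  have hyx : ‖y - x‖ ≤ h := by simpa [dist_eq_norm] using hy
  have f1 : infDist x A ≤ infDist y A - (1 - ε) * ‖y - x‖ := by
    have := hymax (mem_closedBall_self hh.le : x ∈ closedBall x h)
    simpa using this
  have hy0 : 0 < infDist y A := by
    have : 0 ≤ (1 - ε) * ‖y - x‖ := mul_nonneg (by linarith) (norm_nonneg _)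
    linarith
  have hyh : ‖y - x‖ < h := by
    refine lt_of_le_of_ne hyx fun he => ?_
    rw [he] at f1
    have := hmax hy
    simp only [mem_ofPred_eq] at this
    linarith
  have hyR : infDist y A < R := by
    have : infDist y A ≤ infDist x A + dist y x := infDist_le_infDist_add_dist
    rw [dist_eq_norm] at this; linarith
  set n : E2 := (infDist y A)⁻¹ • (y - npt A y) with hn
  have hn1 : ‖n‖ = 1 := by
    rw [hn, norm_smul, norm_sub_npt hne hc, norm_inv, Real.norm_eq_abs, abs_of_pos hy0]
    field_simp
  have hlim : Filter.Tendsto (fun η : ℝ => 2 * inner ℝ n (y + η • n - npt A (y + η • n)) - η -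
      2 * (1 - ε) * infDist y A - (1 - ε) ^ 2 * η) (𝓝[>] 0)
      (𝓝 (2 * inner ℝ n (y - npt A y) - 0 - 2 * (1 - ε) * infDist y A - (1 - ε) ^ 2 * 0)) := by
    have c1 : ContinuousAt (fun η : ℝ => npt A (y + η • n)) 0 := by
      refine ContinuousAt.comp (f := fun η : ℝ => y + η • n) (g := npt A) ?_ (by fun_prop)
      simpa using npt_continuousAt hne hc hU hyR
    have c2 : ContinuousAt (fun η : ℝ => 2 * inner ℝ n (y + η • n - npt A (y + η • n)) - η -
      2 * (1 - ε) * infDist y A - (1 - ε) ^ 2 * η) 0 := by fun_prop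
    have := c2.tendsto
    simp only [zero_smul, add_zero] at this
    exact this.mono_left nhdsWithin_le_nhds
  have hin : inner ℝ n (y - npt A y) = infDist y A := by
    rw [hn, inner_smul_left, real_inner_self_eq_norm_sq, norm_sub_npt hne hc]
    simp; field_simp
  rw [hin] at hlim
  have hev := hlim.eventually (lt_mem_nhds (a := 0) (by nlinarith))
  have hev2 : ∀ᶠ η in 𝓝[>] (0:ℝ), ‖y - x‖ + η < h := by
    have : Filter.Tendsto (fun η : ℝ => ‖y - x‖ + η) (𝓝[>] 0) (𝓝 (‖y - x‖ + 0)) :=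
      (Continuous.tendsto (by fun_prop) 0).mono_left nhdsWithin_le_nhds
    exact this.eventually (gt_mem_nhds (by simpa using hyh))
  obtain ⟨η, ⟨h1, h2⟩, hη⟩ := ((hev.and hev2).and (self_mem_nhdsWithin : Ioi (0:ℝ) ∈ 𝓝[>] (0:ℝ))).exists
  have hη0 : 0 < η := hη
  set z := y + η • n with hz
  have hzx : ‖z - x‖ ≤ ‖y - x‖ + η := by
    have : z - x = (y - x) + η • n := by rw [hz]; abel
    rw [this]
    refine (norm_add_le _ _).trans ?_
    rw [norm_smul, hn1, Real.norm_eq_abs, abs_of_pos hη0, mul_one]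
  have f2 : infDist z A ≤ infDist y A + (1 - ε) * η := by
    have : z ∈ closedBall x h := by rw [mem_closedBall, dist_eq_norm]; linarith
    have := hymax this
    simp only [mem_ofPred_eq] at this
    have : (1 - ε) * ‖z - x‖ ≤ (1 - ε) * (‖y - x‖ + η) :=
      mul_le_mul_of_nonneg_left hzx (by linarith)
    linarith
  have f3 : infDist y A ≤ ‖y - npt A z‖ := infDist_le_norm hne hc (npt_mem hne hc z)
  have f4 : ‖y - npt A z‖ ^ 2 = infDist z A ^ 2 - 2 * η * inner ℝ n (z - npt A z) + η ^ 2 := by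
    have : y - npt A z = (z - npt A z) - η • n := by rw [hz]; abel
    rw [this, norm_sub_sq_real, norm_sub_npt hne hc, norm_smul, hn1, inner_smul_right,
      real_inner_comm, Real.norm_eq_abs, abs_of_pos hη0]
    ring
  have f5 : infDist y A ^ 2 ≤ ‖y - npt A z‖ ^ 2 := by gcongr
  have f6 : infDist z A ^ 2 ≤ (infDist y A + (1 - ε) * η) ^ 2 :=
    pow_le_pow_left₀ infDist_nonneg f2 2
  have f7 : 0 < η * (2 * inner ℝ n (z - npt A z) - η - 2 * (1 - ε) * infDist y A - (1 - ε) ^ 2 * η) :=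
    mul_pos hη0 h1
  nlinarith

/-- normals extend up to length `R` -/
lemma ascent {A : Set E2} (hne : A.Nonempty) (hc : IsCompact A) {R : ℝ} (hU : UNear A R)
    {x : E2} (hx0 : 0 < infDist x A) {h : ℝ} (hh : 0 < h) (hxR : infDist x A + h < R) :
    infDist (x + (h / infDist x A) • (x - npt A x)) A = infDist x A + h := by
  obtain ⟨y, hy, hd⟩ := ascent_aux hne hc hU hx0 hh hxR
  have h1 : infDist y A ≤ ‖y - npt A x‖ := infDist_le_norm hne hc (npt_mem hne hc x)
  have h2 : y - npt A x = (y - x) + (x - npt A x) := by abel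
  have h3 : ‖(y - x) + (x - npt A x)‖ = ‖y - x‖ + ‖x - npt A x‖ := by
    apply le_antisymm (norm_add_le _ _)
    rw [norm_sub_npt hne hc, ← h2]; linarith
  have h5 : ‖y - x‖ = h := by
    rw [← h2, norm_sub_npt hne hc] at h3
    linarith
  have h4 : SameRay ℝ (y - x) (x - npt A x) := sameRay_iff_norm_add.2 h3
  have h6 := h4.norm_smul_eq
  rw [norm_sub_npt hne hc, h5] at h6
  have h7 : (h / infDist x A) • (x - npt A x) = y - x := by
    rw [div_eq_inv_mul, mul_smul, h6, smul_smul, inv_mul_cancel₀ hx0.ne', one_smul]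
  rw [h7, add_sub_cancel]
  have : infDist y A ≤ infDist x A + dist y x := infDist_le_infDist_add_dist
  rw [dist_eq_norm, h5] at this
  linarith

/-- Federer's normal inequality -/
lemma normal_ineq {A : Set E2} (hne : A.Nonempty) (hc : IsCompact A) {R : ℝ} (hU : UNear A R)
    {x b : E2} (hb : b ∈ A) {s : ℝ} (hs0 : 0 < s) (hxs : infDist x A < s) (hs : s < R) :
    inner ℝ (x - npt A x) (b - npt A x) ≤ infDist x A / (2 * s) * ‖b - npt A x‖ ^ 2 := by
  rcases (infDist_nonneg (x := x) (s := A)).eq_or_lt with h0 | h0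
  · have : x - npt A x = 0 := by rw [← norm_eq_zero, norm_sub_npt hne hc, ← h0]
    rw [this, ← h0]; simp
  · have h1 := ascent hne hc hU h0 (h := s - infDist x A) (by linarith) (by linarith)
    have h2 := infDist_le_norm hne hc hb (x := x + ((s - infDist x A) / infDist x A) • (x - npt A x))
    rw [h1] at h2
    set a := npt A x with ha
    set d := infDist x A with hd
    have h3 : x + ((s - d) / d) • (x - a) - b = (s / d) • (x - a) - (b - a) := by
      rw [sub_div, div_self h0.ne', sub_smul, one_smul]; abel
    rw [h3] at h2
    have h4 : s ^ 2 ≤ ‖(s / d) • (x - a) - (b - a)‖ ^ 2 := pow_le_pow_left₀ (by linarith) (by linarith) 2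
    rw [norm_sub_sq_real, norm_smul, inner_smul_left, norm_sub_npt hne hc, ← hd, mul_pow] at h4
    simp only [Real.norm_eq_abs, sq_abs, conj_trivial] at h4
    rw [div_pow, div_mul_cancel₀ _ (by positivity)] at h4
    have h5 : 2 * (s / d * inner ℝ (x - a) (b - a)) ≤ ‖b - a‖ ^ 2 := by linarith
    have h6 : inner ℝ (x - a) (b - a) = d / (2 * s) * (2 * (s / d * inner ℝ (x - a) (b - a))) := by
      field_simp
    rw [h6]
    gcongr

lemma npt_lip {A : Set E2} (hne : A.Nonempty) (hc : IsCompact A) {R : ℝ} (hU : UNear A R)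
    {x y : E2} {r s : ℝ} (hs0 : 0 < s) (hrs : r < s) (hs : s < R)
    (hx : infDist x A ≤ r) (hy : infDist y A ≤ r) :
    ‖npt A x - npt A y‖ ≤ s / (s - r) * ‖x - y‖ := by
  have h1 := normal_ineq hne hc hU (npt_mem hne hc y) hs0 (by linarith) hs (x := x)
  have h2 := normal_ineq hne hc hU (npt_mem hne hc x) hs0 (by linarith) hs (x := y)
  set a := npt A x
  set b := npt A y
  have h3 : infDist x A / (2 * s) * ‖b - a‖ ^ 2 ≤ r / (2 * s) * ‖a - b‖ ^ 2 := by
    rw [norm_sub_rev]; gcongr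
  have h4 : infDist y A / (2 * s) * ‖a - b‖ ^ 2 ≤ r / (2 * s) * ‖a - b‖ ^ 2 := by gcongr
  have h5 : inner ℝ (x - a) (b - a) + inner ℝ (y - b) (a - b) = ‖a - b‖ ^ 2 - inner ℝ (x - y) (a - b) := by
    have e1 : b - a = -(a - b) := by abel
    rw [e1, inner_neg_right, ← real_inner_self_eq_norm_sq, neg_add_eq_sub, ← inner_sub_left, ← inner_sub_left]
    congr 1; abel
  have h6 : r / (2 * s) * ‖a - b‖ ^ 2 + r / (2 * s) * ‖a - b‖ ^ 2 = r / s * ‖a - b‖ ^ 2 := by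
    field_simp; ring
  have h7 := real_inner_le_norm (x - y) (a - b)
  have h8 : (1 - r / s) * ‖a - b‖ ^ 2 ≤ ‖x - y‖ * ‖a - b‖ := by nlinarith
  have h9 : 1 - r / s = (s - r) / s := by field_simp
  rw [h9] at h8
  rcases (norm_nonneg (a - b)).eq_or_lt with h | h
  · rw [← h]; have : 0 < s - r := by linarith
    positivity
  · have h10 : (s - r) / s * ‖a - b‖ ≤ ‖x - y‖ := by
      rw [pow_two, ← mul_assoc] at h8
      exact le_of_mul_le_mul_right h8 h
    have : 0 < s - r := by linarith
    calc ‖a - b‖ = s / (s - r) * ((s - r) / s * ‖a - b‖) := by field_simp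
      _ ≤ _ := by gcongr

lemma scale {A : Set E2} (hne : A.Nonempty) (hc : IsCompact A) {R : ℝ} (hU : UNear A R)
    {x : E2} (hx : infDist x A < R) {μ : ℝ} (hμ : 0 ≤ μ) (hμR : μ * infDist x A < R) :
    npt A (npt A x + μ • (x - npt A x)) = npt A x ∧
      infDist (npt A x + μ • (x - npt A x)) A = μ * infDist x A := by
  set a := npt A x with ha
  set d := infDist x A with hd
  set z := a + μ • (x - a) with hz
  have hd0 : 0 ≤ d := infDist_nonneg
  obtain ⟨s, hs1, hs2⟩ := exists_between (max_lt hx hμR)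
  have hs0 : 0 < s := lt_of_le_of_lt (hd0.trans (le_max_left _ _)) hs1
  have hza : ‖z - a‖ = μ * d := by
    rw [hz, add_sub_cancel_left, norm_smul, norm_sub_npt hne hc, Real.norm_eq_abs, abs_of_nonneg hμ]
  have key : ∀ b ∈ A, μ * d ≤ ‖z - b‖ := by
    intro b hb
    have h1 := normal_ineq hne hc hU hb hs0 (lt_of_le_of_lt (le_max_left _ _) hs1) hs2 (x := x)
    rw [← ha, ← hd] at h1
    have h2 : z - b = (z - a) - (b - a) := by abel
    have h3 : ‖z - b‖ ^ 2 = (μ * d) ^ 2 - 2 * (μ * inner ℝ (x - a) (b - a)) + ‖b - a‖ ^ 2 := by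
      rw [h2, norm_sub_sq_real, hza]
      congr 3
      rw [hz, add_sub_cancel_left, inner_smul_left]; simp
    have h4 : μ * inner ℝ (x - a) (b - a) ≤ μ * (d / (2 * s) * ‖b - a‖ ^ 2) := by gcongr
    have h5 : 2 * (μ * (d / (2 * s) * ‖b - a‖ ^ 2)) = (μ * d) / s * ‖b - a‖ ^ 2 := by field_simp
    have h6 : (μ * d) / s ≤ 1 := by
      rw [div_le_one hs0]; exact ((le_max_right _ _).trans_lt hs1).le
    have h7 : (μ * d) / s * ‖b - a‖ ^ 2 ≤ 1 * ‖b - a‖ ^ 2 := by gcongr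
    refine abs_le_of_sq_le_sq' ?_ (norm_nonneg _) |>.2
    nlinarith
  have hdz : infDist z A = μ * d := by
    apply le_antisymm
    · rw [← hza]; exact infDist_le_norm hne hc (npt_mem hne hc x)
    · rw [← norm_sub_npt hne hc]; exact key _ (npt_mem hne hc z)
  refine ⟨?_, hdz⟩
  exact eq_npt hne hc hU (by rw [hdz]; exact hμR) (npt_mem hne hc x) (by rw [hdz, ← hza])

end dist

lemma lt_sub_le (A : Set E2) (r : ℝ) : {x : E2 | infDist x A < r} ⊆ {x : E2 | infDist x A ≤ r} :=
  fun x (hx : infDist x A < r) => hx.le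

section vol

lemma opn_lt {A : Set E2} (hne : A.Nonempty) (hc : IsCompact A)
    (r : ℝ) : IsOpen {x : E2 | infDist x A < r} :=
  isOpen_lt (continuous_infDist_pt A) continuous_const

lemma cls_le {A : Set E2} (hne : A.Nonempty) (hc : IsCompact A)
    (r : ℝ) : IsClosed {x : E2 | infDist x A ≤ r} :=
  isClosed_le (continuous_infDist_pt A) continuous_const

lemma parSet_eq {A : Set E2} (hne : A.Nonempty) (hc : IsCompact A)
    {r : ℝ} (hr : 0 ≤ r) : {x : E2 | infDist x A ≤ r} = cthickening r A := by
  ext x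
  rw [cthickening, mem_ofPred_eq, mem_ofPred_eq, infDist,
    ← ENNReal.ofReal_le_ofReal_iff hr, ENNReal.ofReal_toReal (infEDist_ne_top hne)]

lemma isCompact_le {A : Set E2} (hne : A.Nonempty) (hc : IsCompact A)
    (r : ℝ) : IsCompact {x : E2 | infDist x A ≤ r} := by
  have : IsCompact {x : E2 | infDist x A ≤ |r|} := by
    rw [parSet_eq hne hc (abs_nonneg r)]; exact hc.cthickening
  exact this.of_isClosed_subset (cls_le hne hc r)
    (fun x (hx : infDist x A ≤ r) => hx.trans (le_abs_self r))

lemma vol_le_ne {A : Set E2} (hne : A.Nonempty) (hc : IsCompact A)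
    (r : ℝ) : volume {x : E2 | infDist x A ≤ r} ≠ ∞ :=
  (isCompact_le hne hc r).measure_lt_top.ne

lemma vol_lt_ne {A : Set E2} (hne : A.Nonempty) (hc : IsCompact A)
    (r : ℝ) : volume {x : E2 | infDist x A < r} ≠ ∞ :=
  ne_top_of_le_ne_top (vol_le_ne hne hc r) (measure_mono (lt_sub_le A r))


lemma Y_lip {A : Set E2} (hne : A.Nonempty) (hc : IsCompact A) {R : ℝ} (hU : UNear A R)
    {r : ℝ} (hr : 0 < r) (hrR : r < R) :
    ∃ K : ℝ≥0, LipschitzOnWith K (fun x => x - npt A x) {x : E2 | infDist x A ≤ r} := by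
  obtain ⟨s, hs1, hs2⟩ := exists_between hrR
  have hp : 0 < s / (s - r) := div_pos (by linarith) (by linarith)
  refine ⟨Real.toNNReal (1 + s / (s - r)), LipschitzOnWith.of_dist_le_mul fun x hx y hy => ?_⟩
  have := npt_lip hne hc hU (by linarith) hs1 hs2 hx hy
  rw [Real.coe_toNNReal _ (by linarith)]
  rw [dist_eq_norm, dist_eq_norm]
  have e : x - npt A x - (y - npt A y) = (x - y) - (npt A x - npt A y) := by abel
  rw [e]
  refine (norm_sub_le _ _).trans ?_
  linarith

lemma T_eq {A : Set E2} (hne : A.Nonempty) (hc : IsCompact A) {R : ℝ} (hU : UNear A R)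
    (x : E2) (τ : ℝ) : x + τ • (x - npt A x) = npt A x + (1 + τ) • (x - npt A x) := by
  rw [add_smul, one_smul]; abel

lemma T_spec {A : Set E2} (hne : A.Nonempty) (hc : IsCompact A) {R : ℝ} (hU : UNear A R)
    {x : E2} {r τ : ℝ} (hr : 0 < r) (hrR : r < R) (hx : infDist x A ≤ r) (h1 : -1 < τ)
    (h2 : (1 + τ) * r < R) :
    npt A (x + τ • (x - npt A x)) = npt A x ∧
      infDist (x + τ • (x - npt A x)) A = (1 + τ) * infDist x A := by
  rw [T_eq hne hc hU]
  refine scale hne hc hU (by linarith) (by linarith) ?_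
  refine lt_of_le_of_lt ?_ h2
  have : 0 < 1 + τ := by linarith
  gcongr

lemma T_anti {A : Set E2} (hne : A.Nonempty) (hc : IsCompact A) {R : ℝ} (hU : UNear A R)
    {r τ : ℝ} (hr : 0 < r) (hrR : r < R) (h1 : -1 < τ) (h2 : (1 + τ) * r < R) :
    ∃ k : ℝ, ∀ x ∈ {x : E2 | infDist x A ≤ r}, ∀ y ∈ {x : E2 | infDist x A ≤ r},
      ‖x - y‖ ≤ k * ‖(x + τ • (x - npt A x)) - (y + τ • (y - npt A y))‖ := by
  have hp : 0 < 1 + τ := by linarith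
  obtain ⟨s, hs1, hs2⟩ := exists_between h2
  have hs0 : 0 < s := lt_trans (by positivity) hs1
  set c := s / (s - (1 + τ) * r)
  refine ⟨(1 + (1 + τ)⁻¹) * c + (1 + τ)⁻¹, fun x hx y hy => ?_⟩
  have hx1 := T_spec hne hc hU hr hrR hx h1 h2
  have hy1 := T_spec hne hc hU hr hrR hy h1 h2
  have ex := T_eq hne hc hU x τ
  have ey := T_eq hne hc hU y τ
  set z := x + τ • (x - npt A x) with hz
  set w := y + τ • (y - npt A y) with hw
  have hzr : infDist z A ≤ (1 + τ) * r := by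
    rw [hx1.2]; exact mul_le_mul_of_nonneg_left hx hp.le
  have hwr : infDist w A ≤ (1 + τ) * r := by
    rw [hy1.2]; exact mul_le_mul_of_nonneg_left hy hp.le
  have hl := npt_lip hne hc hU hs0 hs1 hs2 hzr hwr
  rw [hx1.1, hy1.1] at hl
  have fx : x = npt A x + (1 + τ)⁻¹ • (z - npt A x) := by
    rw [ex, add_sub_cancel_left, smul_smul, inv_mul_cancel₀ hp.ne', one_smul]; abel
  have fy : y = npt A y + (1 + τ)⁻¹ • (w - npt A y) := by
    rw [ey, add_sub_cancel_left, smul_smul, inv_mul_cancel₀ hp.ne', one_smul]; abel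
  have fxy : x - y = (npt A x - npt A y) + (1 + τ)⁻¹ • ((z - w) - (npt A x - npt A y)) := by
    conv_lhs => rw [fx, fy]
    simp only [smul_sub]; abel
  have g1 : ‖x - y‖ ≤ ‖npt A x - npt A y‖ + (1 + τ)⁻¹ * (‖z - w‖ + ‖npt A x - npt A y‖) := by
    rw [fxy]
    refine (norm_add_le _ _).trans ?_
    rw [norm_smul, Real.norm_eq_abs, abs_of_pos (inv_pos.2 hp)]
    gcongr
    exact norm_sub_le _ _
  have hi : 0 < (1 + τ)⁻¹ := inv_pos.2 hp
  nlinarith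

lemma T_image_lt {A : Set E2} (hne : A.Nonempty) (hc : IsCompact A) {R : ℝ} (hU : UNear A R)
    {r τ : ℝ} (hr : 0 < r) (hrR : r < R) (h1 : -1 < τ) (h2 : (1 + τ) * r < R) :
    (fun x => x + τ • (x - npt A x)) '' {x : E2 | infDist x A < r} =
      {x : E2 | infDist x A < (1 + τ) * r} := by
  have hp : 0 < 1 + τ := by linarith
  apply Subset.antisymm
  · rintro _ ⟨x, hx, rfl⟩
    show infDist _ A < _
    rw [(T_spec hne hc hU hr hrR (le_of_lt hx) h1 h2).2]
    exact mul_lt_mul_of_pos_left hx hp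
  · intro z (hz : infDist z A < _)
    have e : (1 + τ)⁻¹ * infDist z A < r := by
      rw [inv_mul_lt_iff₀ hp]; exact hz
    have := scale hne hc hU (x := z) (by linarith) (μ := (1 + τ)⁻¹) (by positivity) (by linarith)
    refine ⟨npt A z + (1 + τ)⁻¹ • (z - npt A z), ?_, ?_⟩
    · show infDist _ A < _
      rw [this.2]; exact e
    · simp only
      rw [T_eq hne hc hU, this.1, add_sub_cancel_left, smul_smul, mul_inv_cancel₀ hp.ne', one_smul]
      abel

lemma T_image_le {A : Set E2} (hne : A.Nonempty) (hc : IsCompact A) {R : ℝ} (hU : UNear A R)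
    {r τ : ℝ} (hr : 0 < r) (hrR : r < R) (h1 : -1 < τ) (h2 : (1 + τ) * r < R) :
    (fun x => x + τ • (x - npt A x)) '' {x : E2 | infDist x A ≤ r} =
      {x : E2 | infDist x A ≤ (1 + τ) * r} := by
  have hp : 0 < 1 + τ := by linarith
  apply Subset.antisymm
  · rintro _ ⟨x, hx, rfl⟩
    show infDist _ A ≤ _
    rw [(T_spec hne hc hU hr hrR hx h1 h2).2]
    exact mul_le_mul_of_nonneg_left hx hp.le
  · intro z (hz : infDist z A ≤ _)
    have e : (1 + τ)⁻¹ * infDist z A ≤ r := by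
      rw [inv_mul_le_iff₀ hp]; exact hz
    have := scale hne hc hU (x := z) (by linarith) (μ := (1 + τ)⁻¹) (by positivity) (by linarith)
    refine ⟨npt A z + (1 + τ)⁻¹ • (z - npt A z), ?_, ?_⟩
    · show infDist _ A ≤ _
      rw [this.2]; exact e
    · simp only
      rw [T_eq hne hc hU, this.1, add_sub_cancel_left, smul_smul, mul_inv_cancel₀ hp.ne', one_smul]
      abel

/-- quadratic coefficient -/
lemma vol_lt_poly {A : Set E2} (hne : A.Nonempty) (hc : IsCompact A) {R : ℝ} (hU : UNear A R)
    {r : ℝ} (hr : 0 < r) (hrR : r < R) : ∃ a b : ℝ, ∀ s, 0 < s → s < R →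
    (volume {x : E2 | infDist x A < s}).toReal = a + b * s +
      (∫ x in {x : E2 | infDist x A < r}, det2 (fderiv ℝ (fun x => x - npt A x) x)) / r ^ 2 * s ^ 2 := by
  set C := ∫ x in {x : E2 | infDist x A < r}, det2 (fderiv ℝ (fun x => x - npt A x) x)
  set B := ∫ x in {x : E2 | infDist x A < r}, tr2 (fderiv ℝ (fun x => x - npt A x) x)
  set W := (volume {x : E2 | infDist x A < r}).toReal
  refine ⟨W - B + C, B / r - 2 * C / r, fun s hs hsR => ?_⟩
  obtain ⟨K, hK⟩ := Y_lip hne hc hU hr hrR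
  have hsub : {x : E2 | infDist x A < r} ⊆ {x : E2 | infDist x A ≤ r} :=
    fun x (hx : infDist x A < r) => hx.le
  have hpos : 0 < s / r := by positivity
  have h1 := area_poly (opn_lt hne hc r) (hK.mono hsub) (opn_lt hne hc r).measurableSet Subset.rfl
    (vol_lt_ne hne hc r) (s / r - 1) (by
      intro τ hτ
      have hτ1 : -1 < τ := by
        rcases mem_uIcc.1 hτ with h | h <;> linarith [h.1]
      have hτ2 : (1 + τ) * r < R := by
        have hsr : (s / r) * r = s := by field_simp
        rcases mem_uIcc.1 hτ with h | h
        · have : (1 + τ) * r ≤ (s / r) * r := by gcongr; linarith [h.2]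
          linarith
        · have : (1 + τ) * r ≤ 1 * r := by gcongr; linarith [h.2]
          linarith
      obtain ⟨k, hk⟩ := T_anti hne hc hU hr hrR hτ1 hτ2
      exact ⟨k, fun x hx y hy => hk x (hsub hx) y (hsub hy)⟩)
  have e : (1 + (s / r - 1)) * r = s := by field_simp; ring
  rw [T_image_lt hne hc hU hr hrR (by linarith) (by rw [e]; exact hsR), e] at h1
  rw [h1]
  field_simp
  ring

lemma vol_le_eq {A : Set E2} (hne : A.Nonempty) (hc : IsCompact A) {R : ℝ} (hU : UNear A R)
    {r : ℝ} (hr : 0 < r) (hrR : r < R) :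
    volume {x : E2 | infDist x A ≤ r} = volume {x : E2 | infDist x A < r} := by
  obtain ⟨a, b, hab⟩ := vol_lt_poly hne hc hU hr hrR
  apply le_antisymm _ (measure_mono (lt_sub_le A r))
  rw [← ENNReal.toReal_le_toReal (vol_le_ne hne hc r) (vol_lt_ne hne hc r), hab r hr hrR]
  set c := (∫ x in {x : E2 | infDist x A < r}, det2 (fderiv ℝ (fun x => x - npt A x) x)) / r ^ 2
  have ht : Filter.Tendsto (fun s : ℝ => a + b * s + c * s ^ 2) (𝓝[>] r) (𝓝 (a + b * r + c * r ^ 2)) :=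
    (Continuous.tendsto (by fun_prop) r).mono_left nhdsWithin_le_nhds
  refine ge_of_tendsto ht ?_
  filter_upwards [Ioo_mem_nhdsGT hrR] with s hs
  rw [← hab s (hr.trans hs.1) hs.2]
  rw [ENNReal.toReal_le_toReal (vol_le_ne hne hc r) (vol_lt_ne hne hc s)]
  exact measure_mono fun x (hx : infDist x A ≤ r) => lt_of_le_of_lt hx hs.1

lemma vol_sphere {A : Set E2} (hne : A.Nonempty) (hc : IsCompact A) {R : ℝ} (hU : UNear A R)
    {r : ℝ} (hr : 0 < r) (hrR : r < R) : volume {x : E2 | infDist x A = r} = 0 := by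
  have h1 := vol_le_eq hne hc hU hr hrR
  have : {x : E2 | infDist x A = r} = {x : E2 | infDist x A ≤ r} \ {x : E2 | infDist x A < r} := by
    ext x; simp only [mem_sdiff, mem_ofPred_eq, not_lt]
    exact ⟨fun h => ⟨h.le, h.ge⟩, fun h => le_antisymm h.1 h.2⟩
  rw [this, measure_sdiff (lt_sub_le A r)
    (opn_lt hne hc r).measurableSet.nullMeasurableSet (vol_lt_ne hne hc r), h1, tsub_self]

/-- Volume polynomial with constant term `|A|`. -/
lemma vol_poly {A : Set E2} (hne : A.Nonempty) (hc : IsCompact A) {R : ℝ} (hU : UNear A R)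
    {r : ℝ} (hr : 0 < r) (hrR : r < R) : ∃ b : ℝ, ∀ s, 0 < s → s < R →
    (volume {x : E2 | infDist x A ≤ s}).toReal = (volume A).toReal + b * s +
      (∫ x in {x : E2 | infDist x A < r}, det2 (fderiv ℝ (fun x => x - npt A x) x)) / r ^ 2 * s ^ 2 := by
  obtain ⟨a, b, hab⟩ := vol_lt_poly hne hc hU hr hrR
  set c := (∫ x in {x : E2 | infDist x A < r}, det2 (fderiv ℝ (fun x => x - npt A x) x)) / r ^ 2
  have hab' : ∀ s, 0 < s → s < R → (volume {x : E2 | infDist x A ≤ s}).toReal = a + b * s + c * s ^ 2 := by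
    intro s h1 h2
    rw [vol_le_eq hne hc hU h1 h2]; exact hab s h1 h2
  have t1 := tendsto_measure_cthickening_of_isCompact (μ := (volume : Measure E2)) hc
  have t2 := ((ENNReal.tendsto_toReal hc.measure_lt_top.ne).comp t1).mono_left
    (nhdsWithin_le_nhds (s := Ioi (0:ℝ)))
  have t3 : Filter.Tendsto (fun s : ℝ => a + b * s + c * s ^ 2) (𝓝[>] 0) (𝓝 (a + b * 0 + c * 0 ^ 2)) :=
    (Continuous.tendsto (by fun_prop) 0).mono_left nhdsWithin_le_nhds
  have t4 := t2.congr' (f₂ := fun s : ℝ => a + b * s + c * s ^ 2) (by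
    filter_upwards [Ioo_mem_nhdsGT (hr.trans hrR)] with s hs
    rw [← hab' s hs.1 hs.2, parSet_eq hne hc hs.1.le]; rfl)
  have := tendsto_nhds_unique t4 t3
  refine ⟨b, fun s h1 h2 => ?_⟩
  rw [hab' s h1 h2, this]; ring

end vol

/-- the identification of the plane with the complex numbers -/
noncomputable def toC : E2 ≃ₗᵢ[ℝ] ℂ := Complex.orthonormalBasisOneI.repr.symm

section theta

lemma lpc_A {A : Set E2} (hne : A.Nonempty) (hc : IsCompact A) {R : ℝ} (hR : 0 < R) (hU : UNear A R)
    : LocallyPathConnectedSpace A := by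
  have : LocallyPathConnectedSpace {x : E2 | infDist x A < R} :=
    (opn_lt hne hc R).locallyPathConnectedSpace
  let q : {x : E2 | infDist x A < R} → A := fun x => ⟨npt A x, npt_mem hne hc x⟩
  have hq : Continuous q := by
    refine Continuous.subtype_mk ?_ _
    rw [continuous_iff_continuousAt]
    intro x
    exact (npt_continuousAt hne hc hU x.2).comp continuous_subtype_val.continuousAt
  have hA : ∀ a ∈ A, infDist a A < R := fun a ha => by rw [infDist_zero_of_mem ha]; exact hR
  let i : A → {x : E2 | infDist x A < R} := fun a => ⟨a, hA a a.2⟩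
  have hi : Continuous i := by
    refine Continuous.subtype_mk continuous_subtype_val _
  have hqi : Function.LeftInverse q i := by
    intro a
    apply Subtype.ext
    refine eq_npt hne hc hU (hA a a.2) a.2 ?_
    show ‖(a:E2) - a‖ ≤ infDist (a:E2) A
    simp [infDist_nonneg]
  exact (Topology.IsQuotientMap.of_inverse hi hq hqi).locallyPathConnectedSpace

lemma exists_log {A : Set E2} (hne : A.Nonempty) (hc : IsCompact A) {R : ℝ} (hR : 0 < R) (hU : UNear A R)
    [SimplyConnectedSpace A] {p₀ : E2} (hp : p₀ ∈ A) {x : E2} (hx : 0 < infDist x A) :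
    ∃ F : C(A, ℂ), F ⟨p₀, hp⟩ = 0 ∧
      ∀ p : A, toC (x - p) = toC (x - p₀) * Complex.exp (F p) := by
  have := lpc_A hne hc hR hU
  have hn : ∀ p ∈ A, toC (x - p) ≠ 0 := by
    intro p hpA h0
    have : x - p = 0 := (map_eq_zero_iff toC toC.injective).1 h0
    rw [sub_eq_zero.1 this, infDist_zero_of_mem hpA] at hx
    exact lt_irrefl _ hx
  let f : C(A, {z : ℂ // z ≠ 0}) := ⟨fun p => ⟨toC (x - p) / toC (x - p₀), div_ne_zero (hn p p.2) (hn p₀ hp)⟩, by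
    refine Continuous.subtype_mk ?_ _
    exact (toC.continuous.comp (by fun_prop)).div_const _⟩
  obtain ⟨F, ⟨h1, h2⟩, -⟩ := Complex.isCoveringMap_exp.existsUnique_continuousMap_lifts f ⟨p₀, hp⟩ 0 (by
    apply Subtype.ext; simp [f]; rw [div_self]; exact sub_ne_zero.2 (by simpa [sub_eq_zero] using hn p₀ hp))
  refine ⟨F, h1, fun p => ?_⟩
  have := congrArg Subtype.val (congrFun h2 p)
  simp only [Function.comp, f, ContinuousMap.coe_mk] at this
  rw [this, mul_div_cancel₀ _ (hn p₀ hp)]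

lemma log_unique {A : Set E2} (hne : A.Nonempty) (hc : IsCompact A) {R : ℝ} (hR : 0 < R) (hU : UNear A R)
    [SimplyConnectedSpace A] {p₀ : E2} (hp : p₀ ∈ A) {F G : A → ℂ} (hF : Continuous F)
    (hG : Continuous G) (h0 : F ⟨p₀, hp⟩ = G ⟨p₀, hp⟩) (h : ∀ p, Complex.exp (F p) = Complex.exp (G p)) :
    F = G := by
  have := Complex.isCoveringMap_exp.eq_of_comp_eq hF hG (by
    ext p; exact h p) ⟨p₀, hp⟩ h0
  exact this

lemma exists_theta {A : Set E2} (hne : A.Nonempty) (hc : IsCompact A) {R : ℝ} (hR : 0 < R) (hU : UNear A R)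
    [SimplyConnectedSpace A] {p₀ : E2} (hp : p₀ ∈ A) :
    ∃ G : E2 → ℂ, ContinuousOn G {x | 0 < infDist x A ∧ infDist x A < R} ∧
      ∀ x, 0 < infDist x A → toC (x - npt A x) = toC (x - p₀) * Complex.exp (G x) := by
  classical
  choose! L hL0 hL using fun (x : E2) (hx : 0 < infDist x A) => exists_log hne hc hR hU hp hx
  refine ⟨fun x => L x ⟨npt A x, npt_mem hne hc x⟩, ?_, fun x hx => hL x hx ⟨npt A x, npt_mem hne hc x⟩⟩
  intro x hx
  apply ContinuousAt.continuousWithinAt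
  obtain ⟨hx0, hxR⟩ := hx
  let ρ : E2 → E2 → ℂ := fun x' p => 1 + toC (x' - x) / toC (x - p)
  have hn : ∀ p ∈ A, ∀ y, 0 < infDist y A → toC (y - p) ≠ 0 := by
    intro p hpA y hy h0
    have : y - p = 0 := (map_eq_zero_iff toC toC.injective).1 h0
    rw [sub_eq_zero.1 this, infDist_zero_of_mem hpA] at hy
    exact lt_irrefl _ hy
  have hρ : ∀ x', dist x' x < infDist x A → ∀ p ∈ A, ρ x' p ∈ Complex.slitPlane := by
    intro x' hx' p hpA
    apply Complex.mem_slitPlane_of_norm_lt_one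
    rw [norm_div, toC.norm_map, toC.norm_map]
    have h1 := infDist_le_norm hne hc hpA (x := x)
    rw [div_lt_one (by linarith), ← dist_eq_norm]
    linarith
  have hρe : ∀ x', ∀ p ∈ A, toC (x' - p) = toC (x - p) * ρ x' p := by
    intro x' p hpA
    simp only [ρ]
    rw [mul_add, mul_div_cancel₀ _ (hn p hpA x hx0), mul_one, ← map_add]
    congr 1; abel
  have key : ∀ x', dist x' x < infDist x A → 0 < infDist x' A → ∀ p : A,
      L x' p = L x p + Complex.log (ρ x' p) - Complex.log (ρ x' p₀) := by
    intro x' hx' hx'0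
    apply congrFun
    apply log_unique hne hc hR hU hp (L x').continuous
    · refine ((L x).continuous.add ?_).sub continuous_const
      rw [continuous_iff_continuousAt]
      intro p
      refine ContinuousAt.clog ?_ (hρ x' hx' p p.2)
      refine continuousAt_const.add (continuousAt_const.div ?_ (hn p p.2 x hx0))
      exact (toC.continuous.comp (by fun_prop)).continuousAt
    · rw [hL0 x' hx'0, hL0 x hx0]; simp
    · intro p
      rw [Complex.exp_sub, Complex.exp_add, Complex.exp_log (Complex.slitPlane_ne_zero (hρ x' hx' p p.2)),
        Complex.exp_log (Complex.slitPlane_ne_zero (hρ x' hx' p₀ hp))]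
      have e1 := hL x' hx'0 p
      have e2 := hL x hx0 p
      rw [hρe x' p p.2, hρe x' p₀ hp, e2] at e1
      rw [eq_div_iff (Complex.slitPlane_ne_zero (hρ x' hx' p₀ hp))]
      apply mul_left_cancel₀ (hn p₀ hp x hx0)
      linear_combination -e1
  have hev : ∀ᶠ x' in 𝓝 x, dist x' x < infDist x A ∧ 0 < infDist x' A := by
    refine Filter.Eventually.and (ball_mem_nhds x hx0) ?_
    exact (continuous_infDist_pt A).continuousAt.eventually (lt_mem_nhds hx0)
  have hcn := npt_continuousAt hne hc hU hxR
  have hs : ContinuousAt (fun x' => (⟨npt A x', npt_mem hne hc x'⟩ : A)) x := by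
    rw [ContinuousAt, tendsto_subtype_rng]; exact hcn
  have hr1 : ContinuousAt (fun x' => Complex.log (ρ x' (npt A x'))) x := by
    refine ContinuousAt.clog ?_ (hρ x (by simpa using hx0) _ (npt_mem hne hc x))
    refine continuousAt_const.add (ContinuousAt.div ?_ ?_ (hn _ (npt_mem hne hc x) x hx0))
    · exact (toC.continuous.comp (by fun_prop)).continuousAt
    · exact toC.continuous.continuousAt.comp (continuousAt_const.sub hcn)
  have hr2 : ContinuousAt (fun x' => Complex.log (ρ x' p₀)) x := by
    refine ContinuousAt.clog ?_ (hρ x (by simpa using hx0) _ hp)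
    refine continuousAt_const.add (ContinuousAt.div_const ?_ _)
    exact (toC.continuous.comp (by fun_prop)).continuousAt
  have hmain : ContinuousAt (fun x' => L x ⟨npt A x', npt_mem hne hc x'⟩ + Complex.log (ρ x' (npt A x'))
      - Complex.log (ρ x' p₀)) x :=
    (((L x).continuous.continuousAt.comp hs).add hr1).sub hr2
  refine hmain.congr ?_
  filter_upwards [hev] with x' hx'
  exact (key x' hx'.1 hx'.2 ⟨npt A x', npt_mem hne hc x'⟩).symm

end theta

section bl
variable {F : Type*} [NormedAddCommGroup F] [NormedSpace ℝ F]

/-- bounded and Lipschitz on a set -/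
def BLOn (f : E2 → F) (S : Set E2) : Prop :=
  ∃ C : ℝ, 0 ≤ C ∧ (∀ x ∈ S, ‖f x‖ ≤ C) ∧ ∀ x ∈ S, ∀ y ∈ S, ‖f x - f y‖ ≤ C * ‖x - y‖

lemma BLOn.mono {f : E2 → F} {S T : Set E2} (h : BLOn f T) (hST : S ⊆ T) : BLOn f S := by
  obtain ⟨C, h0, h1, h2⟩ := h
  exact ⟨C, h0, fun x hx => h1 x (hST hx), fun x hx y hy => h2 x (hST hx) y (hST hy)⟩

lemma BLOn.lipschitz {f : E2 → F} (h : BLOn f univ) : ∃ K : ℝ≥0, LipschitzWith K f := by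
  obtain ⟨C, h0, h1, h2⟩ := h
  refine ⟨⟨C, h0⟩, LipschitzWith.of_dist_le_mul fun x y => ?_⟩
  rw [dist_eq_norm, dist_eq_norm]
  exact h2 x trivial y trivial

lemma BLOn.of_lip {f : E2 → F} {S : Set E2} {K : ℝ≥0} (h : LipschitzOnWith K f S) {M : ℝ}
    (hM : ∀ x ∈ S, ‖f x‖ ≤ M) : BLOn f S := by
  refine ⟨max K M, le_max_of_le_left K.2, fun x hx => (hM x hx).trans (le_max_right _ _), fun x hx y hy => ?_⟩
  have := h.dist_le_mul x hx y hy
  rw [dist_eq_norm, dist_eq_norm] at this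
  exact this.trans (mul_le_mul_of_nonneg_right (le_max_left _ _) (norm_nonneg _))

lemma BLOn.cut {ψ : E2 → ℝ} {g : E2 → F} {S : Set E2} (hψ : BLOn ψ univ) (h0 : ∀ x ∉ S, ψ x = 0)
    (hg : BLOn g S) : BLOn (fun x => ψ x • g x) univ := by
  obtain ⟨C, C0, C1, C2⟩ := hψ
  obtain ⟨D, D0, D1, D2⟩ := hg
  have key : ∀ x ∈ S, ∀ y, ‖ψ x • g x - ψ y • g y‖ ≤ 2 * C * D * ‖x - y‖ := by
    intro x hx y
    have e : 0 ≤ C * D * ‖x - y‖ := by positivity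
    by_cases hy : y ∈ S
    · have : ψ x • g x - ψ y • g y = (ψ x - ψ y) • g x + ψ y • (g x - g y) := by
        rw [sub_smul, smul_sub]; abel
      rw [this]
      refine (norm_add_le _ _).trans ?_
      rw [norm_smul, norm_smul]
      have a1 := mul_le_mul (C2 x trivial y trivial) (D1 x hx) (norm_nonneg _) (by positivity)
      have a2 := mul_le_mul (C1 y trivial) (D2 x hx y hy) (norm_nonneg _) (by positivity)
      nlinarith
    · rw [h0 y hy, zero_smul, sub_zero, norm_smul]
      have a1 := mul_le_mul (C2 x trivial y trivial) (D1 x hx) (norm_nonneg _) (by positivity)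
      rw [h0 y hy, sub_zero] at a1
      nlinarith
  have hCD : 0 ≤ C * D := by positivity
  refine ⟨2 * C * D, by positivity, fun x _ => ?_, fun x _ y _ => ?_⟩
  · by_cases hx : x ∈ S
    · rw [norm_smul]
      have := mul_le_mul (C1 x trivial) (D1 x hx) (norm_nonneg _) (by positivity)
      nlinarith
    · beta_reduce; rw [h0 x hx, zero_smul, norm_zero]; positivity
  · by_cases hx : x ∈ S
    · exact key x hx y
    by_cases hy : y ∈ S
    · have := key y hy x
      rwa [norm_sub_rev, norm_sub_rev x y]
    · beta_reduce; rw [h0 x hx, h0 y hy]; simp; positivity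

lemma BLOn.mul {f g : E2 → ℂ} {S : Set E2} (hf : BLOn f S) (hg : BLOn g S) :
    BLOn (fun x => f x * g x) S := by
  obtain ⟨C, C0, C1, C2⟩ := hf
  obtain ⟨D, D0, D1, D2⟩ := hg
  have hCD : 0 ≤ C * D := by positivity
  refine ⟨2 * C * D, by positivity, fun x hx => ?_, fun x hx y hy => ?_⟩
  · rw [norm_mul]
    have := mul_le_mul (C1 x hx) (D1 x hx) (norm_nonneg _) (by positivity)
    nlinarith
  · have : f x * g x - f y * g y = (f x - f y) * g x + f y * (g x - g y) := by ring
    rw [this]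
    refine (norm_add_le _ _).trans ?_
    rw [norm_mul, norm_mul]
    have a1 := mul_le_mul (C2 x hx y hy) (D1 x hx) (norm_nonneg _) (by positivity)
    have a2 := mul_le_mul (C1 y hy) (D2 x hx y hy) (norm_nonneg _) (by positivity)
    nlinarith

lemma BLOn.expI {a : E2 → ℝ} {S : Set E2} (ha : BLOn a S) :
    BLOn (fun x => Complex.exp (Complex.I * a x)) S := by
  obtain ⟨C, C0, C1, C2⟩ := ha
  refine ⟨max 1 C, by positivity, fun x hx => ?_, fun x hx y hy => ?_⟩
  · beta_reduce; rw [mul_comm, Complex.norm_exp_ofReal_mul_I]; exact le_max_left _ _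
  · have : Complex.exp (Complex.I * a x) - Complex.exp (Complex.I * a y) =
        Complex.exp (a y * Complex.I) * (Complex.exp (Complex.I * ((a x - a y : ℝ) : ℂ)) - 1) := by
      rw [mul_sub, ← Complex.exp_add, mul_one, mul_comm (a y : ℂ)]
      congr 2; push_cast; ring
    rw [this, norm_mul, Complex.norm_exp_ofReal_mul_I, one_mul]
    refine (Real.norm_exp_I_mul_ofReal_sub_one_le).trans ((C2 x hx y hy).trans ?_)
    exact mul_le_mul_of_nonneg_right (le_max_right _ _) (norm_nonneg _)

/-- radial retraction onto the ball of radius δ -/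
noncomputable def ret (δ : ℝ) (z : F) : F := (δ / max δ ‖z‖) • z

lemma norm_ret_le {δ : ℝ} (hδ : 0 < δ) (z : F) : ‖ret δ z‖ ≤ δ := by
  have hm : 0 < max δ ‖z‖ := lt_max_of_lt_left hδ
  rw [ret, norm_smul, Real.norm_of_nonneg (by positivity), div_mul_eq_mul_div, div_le_iff₀ hm]
  exact mul_le_mul_of_nonneg_left (le_max_right _ _) hδ.le

lemma ret_of_le {δ : ℝ} (hδ : 0 < δ) {z : F} (h : ‖z‖ ≤ δ) : ret δ z = z := by
  rw [ret, max_eq_left h, div_self hδ.ne', one_smul]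

lemma ret_of_ge {δ : ℝ} {z : F} (h : δ ≤ ‖z‖) : ret δ z = (δ / ‖z‖) • z := by
  rw [ret, max_eq_right h]

lemma norm_ret_of_ge {δ : ℝ} (hδ : 0 < δ) {z : F} (h : δ ≤ ‖z‖) : ‖ret δ z‖ = δ := by
  rw [ret_of_ge h, norm_smul, Real.norm_of_nonneg (by positivity), div_mul_cancel₀]
  exact (hδ.trans_le h).ne'

lemma ret_lip {δ : ℝ} (hδ : 0 < δ) (z w : F) : ‖ret δ z - ret δ w‖ ≤ 2 * ‖z - w‖ := by
  set m := max δ ‖z‖ with hm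
  set n := max δ ‖w‖ with hn
  have m0 : 0 < m := lt_max_of_lt_left hδ
  have n0 : 0 < n := lt_max_of_lt_left hδ
  have hmn : |n - m| ≤ ‖z - w‖ := by
    have := abs_max_sub_max_le_abs ‖w‖ ‖z‖ δ
    rw [hm, hn, max_comm δ, max_comm δ]
    refine this.trans ?_
    rw [norm_sub_rev]; exact abs_norm_sub_norm_le _ _
  have e : ret δ z - ret δ w = (δ / m) • (z - w) + ((δ / m) * ((n - m) / n)) • w := by
    rw [ret, ret, ← hm, ← hn, smul_sub, sub_add, ← sub_smul]
    congr 2; field_simp; ring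
  rw [e]
  refine (norm_add_le _ _).trans ?_
  rw [norm_smul, norm_smul, norm_mul, norm_div (n - m), Real.norm_of_nonneg (by positivity : 0 ≤ δ / m),
    Real.norm_of_nonneg n0.le, Real.norm_eq_abs]
  have h1 : δ / m ≤ 1 := (div_le_one m0).2 (le_max_left _ _)
  have h2 : ‖w‖ / n ≤ 1 := (div_le_one n0).2 (le_max_right _ _)
  have a1 : δ / m * ‖z - w‖ ≤ ‖z - w‖ := mul_le_of_le_one_left (norm_nonneg _) h1
  have a2 : δ / m * (|n - m| / n) * ‖w‖ ≤ ‖z - w‖ := by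
    calc δ / m * (|n - m| / n) * ‖w‖ = (δ / m) * ((‖w‖ / n) * |n - m|) := by ring
      _ ≤ 1 * (1 * ‖z - w‖) := by gcongr
      _ = _ := by ring
  linarith

lemma BLOn.ret {f : E2 → F} {S : Set E2} {K : ℝ≥0} (h : LipschitzOnWith K f S) {δ : ℝ} (hδ : 0 < δ) :
    BLOn (fun x => ret δ (f x)) S := by
  have : LipschitzOnWith (2 * K) (fun x => _root_.ret δ (f x)) S := by
    refine LipschitzOnWith.of_dist_le_mul fun x hx y hy => ?_
    rw [dist_eq_norm]
    refine (ret_lip hδ _ _).trans ?_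
    have := h.dist_le_mul x hx y hy
    rw [dist_eq_norm] at this
    push_cast; linarith
  exact BLOn.of_lip this (fun x _ => norm_ret_le hδ _)

/-- ramp function -/
noncomputable def ramp (t : ℝ) : ℝ := max 0 (min 1 t)

lemma ramp_lip (s t : ℝ) : |ramp s - ramp t| ≤ |s - t| := by
  unfold ramp
  rw [max_comm 0, max_comm 0, min_comm 1, min_comm 1]
  refine (abs_max_sub_max_le_abs _ _ _).trans ?_
  have := abs_min_sub_min_le_max s 1 t 1
  simpa using this

lemma ramp_nonneg (t : ℝ) : 0 ≤ ramp t := le_max_left _ _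
lemma ramp_le_one (t : ℝ) : ramp t ≤ 1 := max_le zero_le_one (min_le_left _ _)
lemma ramp_zero {t : ℝ} (h : t ≤ 0) : ramp t = 0 := max_eq_left ((min_le_right _ _).trans h)
lemma ramp_one {t : ℝ} (h : 1 ≤ t) : ramp t = 1 := by
  rw [ramp, min_eq_left h]; norm_num

lemma ramp_BL (A : Set E2) {δ : ℝ} (hδ : 0 < δ) (c : ℝ) :
    BLOn (fun x => ramp (infDist x A / δ - c)) univ := by
  have : LipschitzWith (Real.toNNReal (1 / δ)) (fun x => ramp (infDist x A / δ - c)) := by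
    refine LipschitzWith.of_dist_le_mul fun x y => ?_
    rw [Real.coe_toNNReal _ (by positivity), Real.dist_eq]
    refine (ramp_lip _ _).trans ?_
    have h := (lipschitz_infDist_pt A).dist_le_mul x y
    rw [Real.dist_eq] at h
    have e : infDist x A / δ - c - (infDist y A / δ - c) = (1 / δ) * (infDist x A - infDist y A) := by ring
    rw [e, abs_mul, abs_of_nonneg (by positivity : 0 ≤ 1 / δ)]
    gcongr
    simpa using h
  refine BLOn.of_lip this.lipschitzOnWith (M := 1) fun x _ => ?_
  rw [Real.norm_of_nonneg (ramp_nonneg _)]; exact ramp_le_one _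

lemma BLOn.one_sub {f : E2 → ℝ} {S : Set E2} (h : BLOn f S) : BLOn (fun x => 1 - f x) S := by
  obtain ⟨C, C0, C1, C2⟩ := h
  refine ⟨1 + C, by positivity, fun x hx => ?_, fun x hx y hy => ?_⟩
  · refine (norm_sub_le _ _).trans ?_
    rw [norm_one]; linarith [C1 x hx]
  · have : 1 - f x - (1 - f y) = -(f x - f y) := by ring
    rw [this, norm_neg]
    have := C2 x hx y hy
    nlinarith [norm_nonneg (x - y)]

lemma BLOn.comp_li {G : Type*} [NormedAddCommGroup G] [NormedSpace ℝ G] {f : E2 → F} {S : Set E2}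
    (h : BLOn f S) (L : F →ₗᵢ[ℝ] G) : BLOn (fun x => L (f x)) S := by
  obtain ⟨C, C0, C1, C2⟩ := h
  refine ⟨C, C0, fun x hx => ?_, fun x hx y hy => ?_⟩
  · rw [L.norm_map]; exact C1 x hx
  · rw [← map_sub, L.norm_map]; exact C2 x hx y hy

end bl

/-- Lipschitz logarithm -/
lemma log_BL {G : E2 → ℂ} {S : Set E2} (hS : IsCompact S) (hG : ContinuousOn G S) {K : ℝ≥0}
    (hE : LipschitzOnWith K (fun x => Complex.exp (G x)) S) : BLOn (fun x => (G x).im) S := by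
  obtain ⟨M, hM⟩ := hS.exists_bound_of_continuousOn hG
  have hM0 : ∀ x ∈ S, ‖G x‖ ≤ |M| := fun x hx => (hM x hx).trans (le_abs_self M)
  obtain ⟨ε, ε0, hε⟩ := Metric.uniformContinuousOn_iff.1 (hS.uniformContinuousOn_of_continuous hG) (1/2) (by norm_num)
  set C : ℝ := |M| + 2 * |M| / ε + 2 * Real.exp |M| * K with hC
  have e1 : 0 ≤ 2 * |M| / ε := by positivity
  have e2 : 0 ≤ 2 * Real.exp |M| * K := by positivity
  have e3 : 0 ≤ |M| := abs_nonneg _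
  refine ⟨C, by positivity, fun x hx => ?_, fun x hx y hy => ?_⟩
  · refine (Complex.abs_im_le_norm _).trans ((hM0 x hx).trans ?_)
    linarith
  rw [← Complex.sub_im]
  refine (Complex.abs_im_le_norm _).trans ?_
  rcases lt_or_ge (dist x y) ε with h | h
  · have h1 := hε x hx y hy h
    rw [dist_eq_norm] at h1
    have h2 : ‖Complex.exp (G x - G y) - 1 - (G x - G y)‖ ≤ ‖G x - G y‖ ^ 2 :=
      Complex.norm_exp_sub_one_sub_id_le (by linarith)
    have h3 : ‖G x - G y‖ ≤ 2 * ‖Complex.exp (G x - G y) - 1‖ := by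
      have : ‖G x - G y‖ ≤ ‖Complex.exp (G x - G y) - 1‖ + ‖Complex.exp (G x - G y) - 1 - (G x - G y)‖ := by
        have e : G x - G y = (Complex.exp (G x - G y) - 1) - (Complex.exp (G x - G y) - 1 - (G x - G y)) := by ring
        calc ‖G x - G y‖ = ‖(Complex.exp (G x - G y) - 1) - (Complex.exp (G x - G y) - 1 - (G x - G y))‖ := by rw [← e]
          _ ≤ _ := norm_sub_le _ _
      nlinarith [norm_nonneg (G x - G y)]
    have h4 : Complex.exp (G x - G y) - 1 = (Complex.exp (G x) - Complex.exp (G y)) * Complex.exp (- G y) := by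
      rw [sub_mul, ← Complex.exp_add, ← Complex.exp_add]; simp [sub_eq_add_neg]
    have h5 : ‖Complex.exp (- G y)‖ ≤ Real.exp |M| := by
      refine (Complex.norm_exp_le_exp_norm _).trans ?_
      rw [norm_neg]; exact Real.exp_le_exp.2 (hM0 y hy)
    have h6 := hE.dist_le_mul x hx y hy
    rw [dist_eq_norm, dist_eq_norm] at h6
    have h7 : ‖Complex.exp (G x - G y) - 1‖ ≤ K * ‖x - y‖ * Real.exp |M| := by
      rw [h4, norm_mul]; gcongr
    have : 0 ≤ (|M| + 2 * |M| / ε) * ‖x - y‖ := by positivity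
    rw [hC, add_mul]
    nlinarith
  · rw [dist_eq_norm] at h
    have h1 : ‖G x - G y‖ ≤ 2 * |M| := (norm_sub_le _ _).trans (by linarith [hM0 x hx, hM0 y hy])
    have h2 : 2 * |M| ≤ 2 * |M| / ε * ‖x - y‖ := by
      rw [div_mul_eq_mul_div, le_div_iff₀ ε0]
      gcongr
    have : 0 ≤ (|M| + 2 * Real.exp |M| * K) * ‖x - y‖ := by positivity
    rw [hC]
    nlinarith

lemma det2_zero_of_norm_const {f : E2 → E2} {x : E2} {c : ℝ} (hcpos : 0 < c)
    (h : ∀ᶠ y in 𝓝 x, ‖f y‖ = c) : det2 (fderiv ℝ f x) = 0 := by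
  by_cases hd : DifferentiableAt ℝ f x
  swap
  · rw [fderiv_zero_of_not_differentiableAt hd]; simp [det2]
  have h1 : (fun y => inner ℝ (f y) (f y)) =ᶠ[𝓝 x] fun _ => c ^ 2 := by
    filter_upwards [h] with y hy
    rw [real_inner_self_eq_norm_sq, hy]
  have h2 := h1.fderiv_eq (𝕜 := ℝ)
  have h3 : ∀ v, inner ℝ (f x) (fderiv ℝ f x v) = 0 := by
    intro v
    have := congrArg (fun L => L v) h2
    simp only [fderiv_inner_apply ℝ hd hd] at this
    rw [real_inner_comm (f x)] at this
    simp at this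
    exact this
  have hfx : f x ≠ 0 := by
    intro h0
    have := h.self_of_nhds
    rw [h0, norm_zero] at this; linarith
  have i0 := h3 (EuclideanSpace.single 0 1)
  have i1 := h3 (EuclideanSpace.single 1 1)
  simp only [PiLp.inner_apply, Fin.sum_univ_two] at i0 i1
  simp at i0 i1
  unfold det2
  set a := fderiv ℝ f x (EuclideanSpace.single 0 1)
  set b := fderiv ℝ f x (EuclideanSpace.single 1 1)
  have : f x 0 ≠ 0 ∨ f x 1 ≠ 0 := by
    by_contra hcon
    push Not at hcon
    apply hfx; ext i; fin_cases i
    · exact hcon.1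
    · exact hcon.2
  rcases this with h | h
  · apply mul_left_cancel₀ h
    linear_combination (b 1) * i0 - (a 1) * i1
  · apply mul_left_cancel₀ h
    linear_combination (a 0) * i1 - (b 0) * i0

section coef

lemma ret_det (p₀ : E2) {δ : ℝ} (hδ : 0 < δ) {U : Set E2} (hUm : MeasurableSet U) (hb : ball p₀ δ ⊆ U) :
    ∫ x in U, det2 (fderiv ℝ (fun x => ret δ (x - p₀)) x) = Real.pi * δ ^ 2 := by
  have h1 : ∀ᵐ x : E2, det2 (fderiv ℝ (fun x => ret δ (x - p₀)) x) = (ball p₀ δ).indicator (fun _ => (1:ℝ)) x := by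
    have hs : volume (sphere p₀ δ) = 0 := Measure.addHaar_sphere _ _ _
    rw [← compl_mem_ae_iff] at hs
    filter_upwards [hs] with x hx
    have hx' : dist x p₀ ≠ δ := hx
    rcases lt_or_gt_of_ne hx' with h | h
    · rw [indicator_of_mem (by exact h)]
      have : (fun x => ret δ (x - p₀)) =ᶠ[𝓝 x] fun x => x - p₀ := by
        filter_upwards [isOpen_ball.mem_nhds (show x ∈ ball p₀ δ from h)] with y hy
        refine ret_of_le hδ ?_
        rw [← dist_eq_norm]; exact (mem_ball.1 hy).le
      rw [this.fderiv_eq, fderiv_sub_const]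
      simp [det2]
    · rw [indicator_of_notMem (by simpa using h.le)]
      refine det2_zero_of_norm_const hδ ?_
      have : {y : E2 | δ < dist y p₀} ∈ 𝓝 x := (isOpen_lt continuous_const (by fun_prop)).mem_nhds h
      filter_upwards [this] with y hy
      refine norm_ret_of_ge hδ ?_
      rw [← dist_eq_norm]; exact le_of_lt hy
  rw [integral_congr_ae (ae_restrict_of_ae h1), setIntegral_indicator measurableSet_ball,
    inter_eq_right.2 hb]
  simp [Measure.real, EuclideanSpace.volume_ball_fin_two, hδ.le]
  rw [ENNReal.toReal_ofReal Real.pi_pos.le]; ring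


lemma coef_pi {A : Set E2} (hne : A.Nonempty) (hc : IsCompact A) {R : ℝ} (hU : UNear A R)
    [SimplyConnectedSpace A] {δ : ℝ} (hδ : 0 < δ) (hδR : 4 * δ < R) :
    ∫ x in {x : E2 | infDist x A < δ}, det2 (fderiv ℝ (fun x => x - npt A x) x) = Real.pi * δ ^ 2 := by
  obtain ⟨p₀, hp⟩ := hne
  have hne : A.Nonempty := ⟨p₀, hp⟩
  obtain ⟨G, hG, hGe⟩ := exists_theta hne hc (by linarith) hU hp
  obtain ⟨K, hK⟩ := Y_lip hne hc hU (r := 4 * δ) (by linarith) hδR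
  set S : Set E2 := {x | δ ≤ infDist x A ∧ infDist x A ≤ 4 * δ} with hS
  have hSc : IsCompact S := by
    have := (isCompact_le hne hc (4 * δ)).inter_right
      (isClosed_le (continuous_const (y := δ)) (continuous_infDist_pt A))
    convert this using 1
    ext x; simp [hS, and_comm]
  have hGS : ContinuousOn G S := hG.mono fun x hx => ⟨hδ.trans_le hx.1, hx.2.trans_lt hδR⟩
  have hxp : ∀ x, infDist x A ≤ ‖x - p₀‖ := fun x => infDist_le_norm hne hc hp
  have hexp : ∀ x ∈ S, Complex.exp (G x) = toC (x - npt A x) / toC (x - p₀) := by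
    intro x hx
    have h0 : toC (x - p₀) ≠ 0 := by
      rw [← norm_pos_iff, toC.norm_map]
      exact hδ.trans_le (hx.1.trans (hxp x))
    rw [hGe x (hδ.trans_le hx.1), mul_div_cancel_left₀ _ h0]
  have hE : BLOn (fun x => Complex.exp (G x)) S := by
    have h1 : BLOn (fun x => toC (x - npt A x)) S := by
      refine BLOn.comp_li (BLOn.of_lip (hK.mono (fun x hx => hx.2)) (M := 4 * δ) ?_) toC.toLinearIsometry
      intro x hx
      rw [norm_sub_npt hne hc]; exact hx.2
    have h2 : BLOn (fun x => (toC (x - p₀))⁻¹) S := by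
      refine ⟨max (1 / δ) (1 / δ ^ 2), by positivity, fun x hx => ?_, fun x hx y hy => ?_⟩
      · rw [norm_inv, toC.norm_map, inv_eq_one_div]
        refine le_max_of_le_left ?_
        exact one_div_le_one_div_of_le hδ (hx.1.trans (hxp x))
      · have hx0 : δ ≤ ‖toC (x - p₀)‖ := by rw [toC.norm_map]; exact hx.1.trans (hxp x)
        have hy0 : δ ≤ ‖toC (y - p₀)‖ := by rw [toC.norm_map]; exact hy.1.trans (hxp y)
        rw [inv_sub_inv (norm_pos_iff.1 (hδ.trans_le hx0)) (norm_pos_iff.1 (hδ.trans_le hy0)), norm_div,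
          norm_mul, ← map_sub, toC.norm_map, sub_sub_sub_cancel_right, norm_sub_rev]
        have : 1 / δ ^ 2 * ‖x - y‖ ≤ max (1 / δ) (1 / δ ^ 2) * ‖x - y‖ := by
          gcongr; exact le_max_right _ _
        refine le_trans ?_ this
        rw [one_div, inv_mul_eq_div]
        gcongr
        rw [sq]; gcongr
    obtain ⟨C, C0, C1, C2⟩ := h1.mul h2
    refine ⟨C, C0, fun x hx => ?_, fun x hx y hy => ?_⟩
    · have := C1 x hx
      beta_reduce at this ⊢
      rwa [← div_eq_mul_inv, ← hexp x hx] at this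
    · have := C2 x hx y hy
      beta_reduce at this ⊢
      rwa [← div_eq_mul_inv, ← hexp x hx, ← div_eq_mul_inv, ← hexp y hy] at this
  have hΘ : BLOn (fun x => (G x).im) S := by
    obtain ⟨C, C0, C1, C2⟩ := hE
    refine log_BL hSc hGS (K := ⟨C, C0⟩) (LipschitzOnWith.of_dist_le_mul fun x hx y hy => ?_)
    rw [dist_eq_norm, dist_eq_norm]; exact C2 x hx y hy
  -- the cutoffs
  have dd : ∀ x : E2, infDist x A = δ * (infDist x A / δ) := fun x => by field_simp
  let ψ : E2 → ℝ := fun x => 1 - ramp (infDist x A / δ - 2)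
  let χ₁ : E2 → ℝ := fun x => ramp (infDist x A / δ - 1)
  let χ₂ : E2 → ℝ := fun x => 1 - ramp (infDist x A / δ - 3)
  have hψ : BLOn ψ univ := (ramp_BL A hδ 2).one_sub
  have hχ₁ : BLOn χ₁ univ := ramp_BL A hδ 1
  have hχ₂ : BLOn χ₂ univ := (ramp_BL A hδ 3).one_sub
  have hχ : BLOn (fun x => χ₁ x • χ₂ x) univ := hχ₁.cut (S := univ) (by simp) hχ₂
  let a : E2 → ℝ := fun x => (χ₁ x • χ₂ x) • (G x).im
  have ψ1 : ∀ x, infDist x A ≤ 2 * δ → ψ x = 1 := by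
    intro x hx
    simp only [ψ]; rw [ramp_zero, sub_zero]
    rw [sub_nonpos, div_le_iff₀ hδ]; exact hx
  have ψ0 : ∀ x, 3 * δ ≤ infDist x A → ψ x = 0 := by
    intro x hx
    simp only [ψ]; rw [ramp_one, sub_self]
    rw [le_sub_iff_add_le, le_div_iff₀ hδ]; linarith
  have χ₁0 : ∀ x, infDist x A ≤ δ → χ₁ x = 0 := by
    intro x hx
    simp only [χ₁]; rw [ramp_zero]
    rw [sub_nonpos, div_le_iff₀ hδ]; linarith
  have χ₁1 : ∀ x, 2 * δ ≤ infDist x A → χ₁ x = 1 := by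
    intro x hx
    simp only [χ₁]; rw [ramp_one]
    rw [le_sub_iff_add_le, le_div_iff₀ hδ]; linarith
  have χ₂0 : ∀ x, 4 * δ ≤ infDist x A → χ₂ x = 0 := by
    intro x hx
    simp only [χ₂]; rw [ramp_one, sub_self]
    rw [le_sub_iff_add_le, le_div_iff₀ hδ]; linarith
  have χ₂1 : ∀ x, infDist x A ≤ 3 * δ → χ₂ x = 1 := by
    intro x hx
    simp only [χ₂]; rw [ramp_zero, sub_zero]
    rw [sub_nonpos, div_le_iff₀ hδ]; linarith
  have ha : BLOn a univ := by
    refine hχ.cut (S := S) ?_ hΘ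
    intro x hx
    rcases lt_or_ge (infDist x A) δ with h | h
    · rw [χ₁0 x h.le, zero_smul]
    · rw [χ₂0 x, smul_zero]
      by_contra hcon
      exact hx ⟨h, (not_le.1 hcon).le⟩
  let w : E2 → E2 := fun x => toC.symm (toC (ret δ (x - p₀)) * Complex.exp (Complex.I * a x))
  have hw : BLOn w univ := by
    refine BLOn.comp_li (BLOn.mul (BLOn.comp_li (BLOn.ret (K := 1) ?_ hδ) toC.toLinearIsometry) ha.expI)
      toC.symm.toLinearIsometry
    refine LipschitzOnWith.of_dist_le_mul fun x _ y _ => ?_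
    simp
  have hwn : ∀ x, ‖w x‖ = ‖ret δ (x - p₀)‖ := by
    intro x
    simp only [w]
    rw [toC.symm.norm_map, norm_mul, toC.norm_map, mul_comm Complex.I, Complex.norm_exp_ofReal_mul_I, mul_one]
  let u : E2 → E2 := fun x => ψ x • ret δ (x - npt A x)
  let v : E2 → E2 := fun x => ψ x • w x
  obtain ⟨Ku, hu⟩ : ∃ K : ℝ≥0, LipschitzWith K u := by
    refine BLOn.lipschitz (hψ.cut (S := {x : E2 | infDist x A ≤ 4 * δ}) ?_ (BLOn.ret hK hδ))
    intro x hx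
    refine ψ0 x ?_
    have : ¬ infDist x A ≤ 4 * δ := hx
    linarith
  obtain ⟨Kv, hv⟩ : ∃ K : ℝ≥0, LipschitzWith K v :=
    BLOn.lipschitz (hψ.cut (S := univ) (by simp) hw)
  set B : Set E2 := {x | infDist x A ≤ 4 * δ} with hB
  have hBm : MeasurableSet B := (cls_le hne hc _).measurableSet
  have hBv : volume B ≠ ∞ := vol_le_ne hne hc _
  have hsup : ∀ x ∉ B, ψ x = 0 := by
    intro x hx
    refine ψ0 x ?_
    have : ¬ infDist x A ≤ 4 * δ := hx
    linarith
  have iu := null_lagrangian hu hBm hBv (fun x hx => by simp only [u]; rw [hsup x hx, zero_smul])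
  have iv := null_lagrangian hv hBm hBv (fun x hx => by simp only [v]; rw [hsup x hx, zero_smul])
  have nu : IntegrableOn (fun x => det2 (fderiv ℝ u x)) B :=
    integrableOn_det isOpen_univ hu.lipschitzOnWith hBm (subset_univ _) hBv
  have nv : IntegrableOn (fun x => det2 (fderiv ℝ v x)) B :=
    integrableOn_det isOpen_univ hv.lipschitzOnWith hBm (subset_univ _) hBv
  set V : Set E2 := {x | infDist x A < δ} with hV
  have hVo : IsOpen V := opn_lt hne hc δ
  have hVB : V ⊆ B := fun x (hx : infDist x A < δ) => show infDist x A ≤ 4 * δ by linarith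
  -- equality outside
  have huv : ∀ x, 2 * δ ≤ infDist x A → u x = v x := by
    intro x hx
    simp only [u, v]
    rcases lt_or_ge (infDist x A) (3 * δ) with h | h
    swap
    · rw [ψ0 x h, zero_smul, zero_smul]
    congr 1
    apply toC.injective
    have hd : 0 < infDist x A := by linarith
    have ax : a x = (G x).im := by
      simp only [a]; rw [χ₁1 x hx, χ₂1 x h.le]; simp
    have hG1 := hGe x hd
    have n1 : δ ≤ ‖x - npt A x‖ := by rw [norm_sub_npt hne hc]; linarith
    have n2 : δ ≤ ‖x - p₀‖ := by linarith [hxp x]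
    have hn := congrArg norm hG1
    rw [norm_mul, toC.norm_map, toC.norm_map, Complex.norm_exp] at hn
    simp only [w]
    rw [toC.apply_symm_apply, ret_of_ge n1, ret_of_ge n2, map_smul, map_smul, hG1, ax, hn]
    have hGd : Complex.exp (G x) = (Real.exp (G x).re : ℂ) * Complex.exp (Complex.I * (G x).im) := by
      rw [Complex.ofReal_exp, ← Complex.exp_add]
      congr 1
      rw [mul_comm]; exact (Complex.re_add_im _).symm
    rw [hGd]
    have hp0 : (‖x - p₀‖ : ℂ) ≠ 0 := by exact_mod_cast (hδ.trans_le n2).ne'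
    have he0 : (Real.exp (G x).re : ℂ) ≠ 0 := by exact_mod_cast (Real.exp_pos _).ne'
    rw [Complex.real_smul, Complex.real_smul]
    push_cast
    rw [Complex.ofReal_exp] at he0
    field_simp
  have hD : ∀ᵐ x : E2, x ∈ B \ V → det2 (fderiv ℝ u x) - det2 (fderiv ℝ v x) = 0 := by
    have s1 := vol_sphere hne hc hU hδ (by linarith)
    have s2 := vol_sphere hne hc hU (r := 2 * δ) (by linarith) (by linarith)
    rw [← compl_mem_ae_iff] at s1 s2
    filter_upwards [s1, s2] with x h1 h2 hx
    have h1 : infDist x A ≠ δ := h1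
    have h2 : infDist x A ≠ 2 * δ := h2
    have h3 : ¬ infDist x A < δ := hx.2
    have h4 : δ < infDist x A := lt_of_le_of_ne (not_lt.1 h3) h1.symm
    rcases lt_or_gt_of_ne h2 with h5 | h5
    · have hO : {y : E2 | δ < infDist y A ∧ infDist y A < 2 * δ} ∈ 𝓝 x :=
        ((isOpen_lt continuous_const (continuous_infDist_pt A)).inter
          (isOpen_lt (continuous_infDist_pt A) continuous_const)).mem_nhds ⟨h4, h5⟩
      rw [det2_zero_of_norm_const hδ, det2_zero_of_norm_const hδ, sub_zero]
      · filter_upwards [hO] with y hy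
        simp only [v]
        rw [ψ1 y hy.2.le, one_smul, hwn]
        exact norm_ret_of_ge hδ (by linarith [hxp y, hy.1])
      · filter_upwards [hO] with y hy
        simp only [u]
        rw [ψ1 y hy.2.le, one_smul]
        refine norm_ret_of_ge hδ ?_
        rw [norm_sub_npt hne hc]; exact hy.1.le
    · have hO : {y : E2 | 2 * δ < infDist y A} ∈ 𝓝 x :=
        (isOpen_lt continuous_const (continuous_infDist_pt A)).mem_nhds h5
      have : u =ᶠ[𝓝 x] v := by
        filter_upwards [hO] with y hy
        exact huv y (le_of_lt hy)
      rw [this.fderiv_eq, sub_self]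
  have hI : ∫ x in V, (det2 (fderiv ℝ u x) - det2 (fderiv ℝ v x)) = 0 := by
    rw [← setIntegral_eq_of_subset_of_ae_sdiff_eq_zero hBm.nullMeasurableSet hVB hD, integral_sub nu nv, iu, iv, sub_zero]
  rw [integral_sub (nu.mono_set hVB) (nv.mono_set hVB), sub_eq_zero] at hI
  have ju : ∫ x in V, det2 (fderiv ℝ u x) = ∫ x in V, det2 (fderiv ℝ (fun x => x - npt A x) x) := by
    refine setIntegral_congr_fun hVo.measurableSet fun x hx => ?_
    have : u =ᶠ[𝓝 x] fun x => x - npt A x := by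
      filter_upwards [hVo.mem_nhds hx] with y hy
      have hy : infDist y A < δ := hy
      simp only [u]
      rw [ψ1 y (by linarith), one_smul, ret_of_le hδ]
      rw [norm_sub_npt hne hc]; exact hy.le
    simp only [this.fderiv_eq]
  have jv : ∫ x in V, det2 (fderiv ℝ v x) = ∫ x in V, det2 (fderiv ℝ (fun x => ret δ (x - p₀)) x) := by
    refine setIntegral_congr_fun hVo.measurableSet fun x hx => ?_
    have : v =ᶠ[𝓝 x] fun x => ret δ (x - p₀) := by
      filter_upwards [hVo.mem_nhds hx] with y hy
      have hy : infDist y A < δ := hy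
      have : a y = 0 := by simp only [a]; rw [χ₁0 y hy.le]; simp
      simp only [v, w]
      rw [ψ1 y (by linarith), one_smul, this]
      simp
    simp only [this.fderiv_eq]
  rw [← ju, hI, jv]
  refine ret_det p₀ hδ hVo.measurableSet ?_
  intro y hy
  have : dist y p₀ < δ := hy
  rw [dist_eq_norm] at this
  exact (hxp y).trans_lt this

lemma steiner_vol {A : Set E2} (hne : A.Nonempty) (hc : IsCompact A) {R : ℝ} (hU : UNear A R)
    [SimplyConnectedSpace A] (hR : 0 < R) : ∃ b, ∀ s, 0 < s → s < R →
    (volume {x : E2 | infDist x A ≤ s}).toReal = (volume A).toReal + b * s + Real.pi * s ^ 2 := by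
  obtain ⟨b, hb⟩ := vol_poly hne hc hU (r := R / 5) (by linarith) (by linarith)
  refine ⟨b, fun s h1 h2 => ?_⟩
  rw [hb s h1 h2, coef_pi hne hc hU (by linarith) (by linarith), mul_div_cancel_right₀]
  positivity

end coef

lemma mollify {Φ : E2 → E2} {K : ℝ≥0} (hΦ : LipschitzWith K Φ) (hs : HasCompactSupport Φ)
    (h1 : ∀ x, ‖Φ x‖ ≤ 1) {ε : ℝ} (hε : 0 < ε) :
    ∃ φ : E2 → E2, ContDiff ℝ 1 φ ∧ HasCompactSupport φ ∧ (∀ x, ‖φ x‖ ≤ 1) ∧ LipschitzWith K φ ∧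
      ∀ x, ‖φ x - Φ x‖ ≤ ε := by
  set η : ℝ := ε / (K + 1) with hη
  have η0 : 0 < η := by positivity
  let β : ContDiffBump (0 : E2) := ⟨η / 2, η, half_pos η0, half_lt_self η0⟩
  let ρ : E2 → ℝ := β.normed volume
  have ρc : Continuous ρ := β.continuous_normed
  have ρs : HasCompactSupport ρ := β.hasCompactSupport_normed
  have ρ0 : ∀ x, 0 ≤ ρ x := β.nonneg_normed
  have ρ1 : ∫ x, ρ x = 1 := β.integral_normed
  have ρi : Integrable ρ := ρc.integrable_of_hasCompactSupport ρs
  have hintg : ∀ x, Integrable (fun y => ρ y • Φ (x - y)) := by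
    intro x
    refine Continuous.integrable_of_hasCompactSupport ?_ (ρs.smul_right)
    exact ρc.smul (hΦ.continuous.comp (by fun_prop))
  refine ⟨MeasureTheory.convolution ρ Φ (ContinuousLinearMap.lsmul ℝ ℝ) volume, ?_, ?_, ?_, ?_, ?_⟩
  · exact ρs.contDiff_convolution_left (n := 1) _ β.contDiff_normed hΦ.continuous.locallyIntegrable
  · exact ρs.convolution _ hs
  · intro x
    simp only [MeasureTheory.convolution, ContinuousLinearMap.lsmul_apply]
    refine (norm_integral_le_of_norm_le ρi (Filter.Eventually.of_forall fun y => ?_)).trans ρ1.le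
    rw [norm_smul, Real.norm_of_nonneg (ρ0 y)]
    exact mul_le_of_le_one_right (ρ0 y) (h1 _)
  · refine LipschitzWith.of_dist_le_mul fun x x' => ?_
    rw [dist_eq_norm]
    simp only [MeasureTheory.convolution, ContinuousLinearMap.lsmul_apply]
    rw [← integral_sub (hintg x) (hintg x')]
    have : ∫ y, ρ y * (K * dist x x') = K * dist x x' := by
      rw [integral_mul_const, ρ1, one_mul]
    refine (norm_integral_le_of_norm_le (ρi.mul_const _) (Filter.Eventually.of_forall fun y => ?_)).trans this.le
    rw [← smul_sub, norm_smul, Real.norm_of_nonneg (ρ0 y)]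
    refine mul_le_mul_of_nonneg_left ?_ (ρ0 y)
    have := hΦ.dist_le_mul (x - y) (x' - y)
    rwa [dist_eq_norm, dist_sub_right] at this
  · intro x
    rw [← dist_eq_norm]
    refine β.dist_normed_convolution_le hΦ.continuous.aestronglyMeasurable fun y hy => ?_
    refine (hΦ.dist_le_mul _ _).trans ?_
    have hy' : dist y x ≤ η := (mem_ball.1 hy).le
    calc (K : ℝ) * dist y x ≤ K * η := by gcongr
      _ ≤ (K + 1) * η := by gcongr; linarith
      _ = ε := by rw [hη]; field_simp

lemma abs_int_det {φ : E2 → E2} {K : ℝ≥0} (hφ : LipschitzWith K φ) {S : Set E2} (hS : volume S ≠ ∞) :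
    |∫ x in S, det2 (fderiv ℝ φ x)| ≤ 2 * (K : ℝ) ^ 2 * (volume S).toReal := by
  rw [← Real.norm_eq_abs]
  refine norm_setIntegral_le_of_norm_le_const (lt_top_iff_ne_top.2 hS) fun x _ => ?_
  refine (abs_det2_le _).trans ?_
  have := norm_fderiv_le_of_lipschitz ℝ hφ (x₀ := x)
  gcongr

section per

lemma per_upper {A : Set E2} (hne : A.Nonempty) (hc : IsCompact A) {R : ℝ}
    {r b : ℝ} (hr : 0 < r) (hrR : r < R)
    (hb : ∀ s, 0 < s → s < R →
      (volume {x : E2 | infDist x A ≤ s}).toReal = (volume A).toReal + b * s + Real.pi * s ^ 2)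
    {φ : E2 → E2} (hφ : ContDiff ℝ 1 φ) (hs : HasCompactSupport φ) (h1 : ∀ x, ‖φ x‖ ≤ 1) :
    ∫ x in {x : E2 | infDist x A ≤ r}, vdiv φ x ≤ b + 2 * Real.pi * r := by
  obtain ⟨K, hK⟩ := hφ.lipschitzWith_of_hasCompactSupport hs one_ne_zero
  set S : Set E2 := {x : E2 | infDist x A ≤ r} with hS
  have hSm : MeasurableSet S := (cls_le hne hc r).measurableSet
  have hSv : volume S ≠ ∞ := vol_le_ne hne hc r
  set C : ℝ := 2 * (K : ℝ) ^ 2 * (volume S).toReal with hC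
  have hI : ∫ x in S, vdiv φ x = ∫ x in S, tr2 (fderiv ℝ φ x) := rfl
  rw [hI]
  have key : ∀ᶠ t in 𝓝[>] (0:ℝ), ∫ x in S, tr2 (fderiv ℝ φ x) ≤ b + 2 * Real.pi * r + t * (Real.pi + C) := by
    have e1 : ∀ᶠ t in 𝓝[>] (0:ℝ), t < R - r := nhdsWithin_le_nhds (gt_mem_nhds (by linarith))
    have e2 : ∀ᶠ t in 𝓝[>] (0:ℝ), t < 1 / ((K:ℝ) + 1) := nhdsWithin_le_nhds (gt_mem_nhds (by positivity))
    filter_upwards [e1, e2, self_mem_nhdsWithin] with t ht1 ht2 ht0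
    have ht0 : 0 < t := ht0
    have htK : |t| * K < 1 := by
      rw [abs_of_pos ht0]
      rw [lt_div_iff₀ (by positivity)] at ht2
      nlinarith
    have ha := area_small hK hSm hSv htK
    have hd := abs_le.1 (abs_int_det hK hSv)
    have hsub : (fun x => x + t • φ x) '' S ⊆ {x : E2 | infDist x A ≤ r + t} := by
      rintro _ ⟨x, hx, rfl⟩
      have hx : infDist x A ≤ r := hx
      show infDist (x + t • φ x) A ≤ r + t
      have := infDist_le_infDist_add_dist (s := A) (x := x + t • φ x) (y := x)
      have e : dist (x + t • φ x) x ≤ t := by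
        rw [dist_eq_norm, add_sub_cancel_left, norm_smul, Real.norm_of_nonneg ht0.le]
        exact mul_le_of_le_one_right ht0.le (h1 x)
      linarith
    have hm := ENNReal.toReal_mono (vol_le_ne hne hc (r + t)) (measure_mono hsub)
    rw [ha, hb (r + t) (by linarith) (by linarith), hb r hr hrR] at hm
    have : t * ∫ x in S, tr2 (fderiv ℝ φ x) ≤ t * (b + 2 * Real.pi * r + t * (Real.pi + C)) := by
      nlinarith [hd.1, hd.2, sq_nonneg t]
    exact le_of_mul_le_mul_left this ht0
  have hlim : Filter.Tendsto (fun t : ℝ => b + 2 * Real.pi * r + t * (Real.pi + C)) (𝓝[>] 0) (𝓝 (b + 2 * Real.pi * r)) := by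
    have : Continuous (fun t : ℝ => b + 2 * Real.pi * r + t * (Real.pi + C)) := by fun_prop
    have := this.tendsto 0
    simp only [zero_mul, add_zero] at this
    exact this.mono_left nhdsWithin_le_nhds
  exact ge_of_tendsto hlim key


lemma exists_field {A : Set E2} (hne : A.Nonempty) (hc : IsCompact A) {R : ℝ} (hU : UNear A R)
    {r : ℝ} (hr : 0 < r) (hrR : r < R) :
    ∃ (Φ : E2 → E2) (K : ℝ≥0), LipschitzWith K Φ ∧ HasCompactSupport Φ ∧ (∀ x, ‖Φ x‖ ≤ 1) ∧
      ∀ x, infDist x A ≤ r → Φ x = r⁻¹ • (x - npt A x) := by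
  obtain ⟨K0, hK0⟩ := Y_lip hne hc hU hr hrR
  obtain ⟨g, hg, hgE⟩ := hK0.extend_finite_dimension
  have h1 : BLOn (fun x => ret r (g x)) univ := BLOn.ret hg.lipschitzOnWith hr
  have h2 : BLOn (fun x => (1 - ramp (infDist x A / r - 1)) • ret r (g x)) univ :=
    (ramp_BL A hr 1).one_sub.cut (S := univ) (by simp) h1
  obtain ⟨K, hK⟩ := h2.lipschitz
  refine ⟨fun x => r⁻¹ • ((1 - ramp (infDist x A / r - 1)) • ret r (g x)), ‖r⁻¹‖₊ * K, ?_, ?_, ?_, ?_⟩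
  · exact (lipschitzWith_smul r⁻¹).comp hK
  · refine HasCompactSupport.intro (isCompact_le hne hc (2 * r)) fun x hx => ?_
    have hx : ¬ infDist x A ≤ 2 * r := hx
    rw [ramp_one, sub_self, zero_smul, smul_zero]
    rw [le_sub_iff_add_le, le_div_iff₀ hr]; linarith
  · intro x
    rw [norm_smul, norm_smul, norm_inv, Real.norm_of_nonneg hr.le, inv_mul_le_iff₀ hr, mul_one]
    have a1 := ramp_nonneg (infDist x A / r - 1)
    have a2 := ramp_le_one (infDist x A / r - 1)
    rw [Real.norm_of_nonneg (by linarith)]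
    have := norm_ret_le hr (g x)
    nlinarith [norm_nonneg (ret r (g x))]
  · intro x hx
    have e : g x = x - npt A x := (hgE hx).symm
    beta_reduce
    rw [ramp_zero, sub_zero, one_smul, e, ret_of_le hr]
    · rw [norm_sub_npt hne hc]; exact hx
    · rw [sub_nonpos, div_le_iff₀ hr]; linarith

lemma per_lower {A : Set E2} (hne : A.Nonempty) (hc : IsCompact A) {R : ℝ} (hU : UNear A R)
    {r b : ℝ} (hr : 0 < r) (hrR : r < R)
    (hb : ∀ s, 0 < s → s < R →
      (volume {x : E2 | infDist x A ≤ s}).toReal = (volume A).toReal + b * s + Real.pi * s ^ 2) :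
    ENNReal.ofReal (b + 2 * Real.pi * r) ≤ perimeter {x : E2 | infDist x A ≤ r} := by
  obtain ⟨Φ, K, hK, hs, h1, hΦ⟩ := exists_field hne hc hU hr hrR
  set S : Set E2 := {x : E2 | infDist x A ≤ r} with hS
  have hSm : MeasurableSet S := (cls_le hne hc r).measurableSet
  have hSv : volume S ≠ ∞ := vol_le_ne hne hc r
  set C : ℝ := 2 * (K : ℝ) ^ 2 * (volume S).toReal with hC
  have key : ∀ᶠ t in 𝓝[>] (0:ℝ), ENNReal.ofReal (b + 2 * Real.pi * r - t * (b + 2 * Real.pi * r + C)) ≤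
      perimeter S := by
    have e1 : ∀ᶠ t in 𝓝[>] (0:ℝ), t < R - r := nhdsWithin_le_nhds (gt_mem_nhds (by linarith))
    have e2 : ∀ᶠ t in 𝓝[>] (0:ℝ), t < 1 / ((K:ℝ) + 1) := nhdsWithin_le_nhds (gt_mem_nhds (by positivity))
    have e3 : ∀ᶠ t in 𝓝[>] (0:ℝ), t < 1 := nhdsWithin_le_nhds (gt_mem_nhds (by positivity))
    filter_upwards [e1, e2, e3, self_mem_nhdsWithin] with t ht1 ht2 ht3 ht0
    have ht0 : 0 < t := ht0
    have htK : |t| * K < 1 := by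
      rw [abs_of_pos ht0]
      rw [lt_div_iff₀ (by positivity)] at ht2
      nlinarith
    obtain ⟨φ, c1, c2, c3, c4, c5⟩ := mollify hK hs h1 ht0
    have ha := area_small c4 hSm hSv htK
    have hd := abs_le.1 (abs_int_det c4 hSv)
    have hsub : {x : E2 | infDist x A ≤ r + t - t ^ 2} ⊆ (fun x => x + t • φ x) '' S := by
      intro y hy
      have hy : infDist y A ≤ r + t - t ^ 2 := hy
      obtain ⟨x, rfl⟩ := small_surj c4 htK y
      refine ⟨x, ?_, rfl⟩
      beta_reduce at hy
      have hz : infDist (x + t • Φ x) A ≤ (1 + t / r) * r := by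
        have h := infDist_le_infDist_add_dist (s := A) (x := x + t • Φ x) (y := x + t • φ x)
        have e : dist (x + t • Φ x) (x + t • φ x) ≤ t * t := by
          rw [dist_add_left, dist_eq_norm, ← smul_sub, norm_smul, Real.norm_of_nonneg ht0.le, norm_sub_rev]
          exact mul_le_mul_of_nonneg_left (c5 x) ht0.le
        have : (1 + t / r) * r = r + t := by field_simp
        rw [this]; nlinarith
      have hq1 : 0 < t / r := by positivity
      have hq2 : (1 + t / r) * r = r + t := by field_simp
      have him := T_image_le hne hc hU hr hrR (τ := t / r) (by linarith) (by linarith)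
      have hz' : x + t • Φ x ∈ {x : E2 | infDist x A ≤ (1 + t / r) * r} := hz
      rw [← him] at hz'
      obtain ⟨x', hx', hxx⟩ := hz'
      have : x' + t • Φ x' = x + t • Φ x := by
        rw [← hxx, hΦ x' hx', smul_smul]; rfl
      rw [← small_inj hK htK this]
      exact hx'
    have hfin : volume ((fun x => x + t • φ x) '' S) ≠ ∞ := by
      have hcp : IsCompact ((fun x => x + t • φ x) '' S) :=
        (isCompact_le hne hc r).image (by have := c4.continuous; fun_prop)
      exact hcp.measure_lt_top.ne
    have hm := ENNReal.toReal_mono hfin (measure_mono hsub)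
    have ht2' : t ^ 2 < t := by nlinarith
    rw [ha, hb (r + t - t ^ 2) (by linarith) (by nlinarith [sq_nonneg t]), hb r hr hrR] at hm
    have hfinal : b + 2 * Real.pi * r - t * (b + 2 * Real.pi * r + C) ≤ ∫ x in S, vdiv φ x := by
      have hI : ∫ x in S, vdiv φ x = ∫ x in S, tr2 (fderiv ℝ φ x) := rfl
      rw [hI]
      have hp : 0 ≤ Real.pi * (t - t ^ 2) ^ 2 := by positivity
      have hdd : t ^ 2 * (∫ x in S, det2 (fderiv ℝ φ x)) ≤ t ^ 2 * C :=
        mul_le_mul_of_nonneg_left hd.2 (sq_nonneg t)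
      refine le_of_mul_le_mul_left ?_ ht0
      nlinarith
    refine (ENNReal.ofReal_le_ofReal hfinal).trans ?_
    unfold perimeter perimeterIn
    exact le_iSup_of_le φ (le_iSup_of_le c1 (le_iSup_of_le c2 (le_iSup_of_le (subset_univ _)
      (le_iSup_of_le c3 le_rfl))))
  have hlim : Filter.Tendsto (fun t : ℝ => ENNReal.ofReal (b + 2 * Real.pi * r - t * (b + 2 * Real.pi * r + C)))
      (𝓝[>] 0) (𝓝 (ENNReal.ofReal (b + 2 * Real.pi * r))) := by
    have : Continuous (fun t : ℝ => b + 2 * Real.pi * r - t * (b + 2 * Real.pi * r + C)) := by fun_prop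
    have := (ENNReal.continuous_ofReal.comp this).tendsto 0
    simp only [zero_mul, sub_zero, Function.comp_def] at this
    exact this.mono_left nhdsWithin_le_nhds
  exact le_of_tendsto hlim key

lemma per_eq {A : Set E2} (hne : A.Nonempty) (hc : IsCompact A) {R : ℝ} (hU : UNear A R)
    {r b : ℝ} (hr : 0 < r) (hrR : r < R)
    (hb : ∀ s, 0 < s → s < R →
      (volume {x : E2 | infDist x A ≤ s}).toReal = (volume A).toReal + b * s + Real.pi * s ^ 2) :
    perimeter {x : E2 | infDist x A ≤ r} = ENNReal.ofReal (b + 2 * Real.pi * r) := by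
  refine le_antisymm ?_ (per_lower hne hc hU hr hrR hb)
  unfold perimeter perimeterIn
  refine iSup_le fun φ => iSup_le fun c1 => iSup_le fun c2 => iSup_le fun _ => iSup_le fun c3 => ?_
  exact ENNReal.ofReal_le_ofReal (per_upper hne hc hr hrR hb c1 c2 c3)

end per

lemma exists_UNear {A : Set E2} (hne : A.Nonempty) {r : ℝ} (h0 : 0 ≤ r) (h : ENNReal.ofReal r < reach A) :
    ∃ R, r < R ∧ UNear A R := by
  obtain ⟨r', hr', hlt⟩ := lt_sSup_iff.1 h
  obtain ⟨R, hR0, h1, h2⟩ := ENNReal.lt_iff_exists_real_btwn.1 hlt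
  refine ⟨R, ?_, ?_⟩
  · exact (ENNReal.ofReal_lt_ofReal_iff_of_nonneg h0).1 h1
  · intro x hx y hy z hz hxy hxz
    have hle : infEDist x A ≤ r' := by
      have e : infEDist x A = ENNReal.ofReal (infDist x A) := by
        rw [infDist, ENNReal.ofReal_toReal (infEDist_ne_top hne)]
      rw [e]
      exact (ENNReal.ofReal_le_ofReal hx.le).trans h2.le
    exact (hr' x hle).unique ⟨hy, hxy⟩ ⟨hz, hxz⟩

theorem steiner_formulas_positive_reach (A : Set (EuclideanSpace ℝ (Fin 2)))
    (hne : A.Nonempty) (hcpt : IsCompact A) (hsc : SimplyConnectedSpace A)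
    (hreach : 0 < reach A) :
    ∃ M : ℝ,
      Filter.Tendsto (fun r : ℝ => ((volume (parSet A r)).toReal - (volume A).toReal) / r)
        (nhdsWithin 0 (Set.Ioi 0)) (nhds M) ∧
      ∀ r : ℝ, 0 < r → ENNReal.ofReal r < reach A →
        volume (parSet A r) = volume A + ENNReal.ofReal (M * r + Real.pi * r ^ 2) ∧
        perimeter (parSet A r) = ENNReal.ofReal (M + 2 * Real.pi * r) := by
  have hlim : ∀ R b : ℝ, 0 < R → (∀ s, 0 < s → s < R →
      (volume {x : E2 | infDist x A ≤ s}).toReal = (volume A).toReal + b * s + Real.pi * s ^ 2) →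
      Filter.Tendsto (fun r : ℝ => ((volume (parSet A r)).toReal - (volume A).toReal) / r)
        (nhdsWithin 0 (Set.Ioi 0)) (nhds b) := by
    intro R b hR hb
    have h1 : Filter.Tendsto (fun t : ℝ => b + Real.pi * t) (𝓝[>] 0) (𝓝 b) := by
      have : Continuous (fun t : ℝ => b + Real.pi * t) := by fun_prop
      have := this.tendsto 0
      simp only [mul_zero, add_zero] at this
      exact this.mono_left nhdsWithin_le_nhds
    refine h1.congr' ?_
    have e1 : ∀ᶠ t in 𝓝[>] (0:ℝ), t < R := nhdsWithin_le_nhds (gt_mem_nhds hR)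
    filter_upwards [e1, self_mem_nhdsWithin] with t ht ht0
    have ht0 : 0 < t := ht0
    have := hb t ht0 ht
    unfold parSet
    rw [this, eq_div_iff ht0.ne']; ring
  obtain ⟨R₀, hR₀, hU₀⟩ := exists_UNear hne le_rfl (by simpa using hreach)
  obtain ⟨M, hM⟩ := steiner_vol hne hcpt hU₀ hR₀
  have hMlim := hlim R₀ M hR₀ hM
  refine ⟨M, hMlim, fun r hr hrr => ?_⟩
  obtain ⟨R, hrR, hU⟩ := exists_UNear hne hr.le hrr
  have hR : 0 < R := hr.trans hrR
  obtain ⟨b, hb⟩ := steiner_vol hne hcpt hU hR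
  have hbM : b = M := tendsto_nhds_unique (hlim R b hR hb) hMlim
  subst hbM
  refine ⟨?_, per_eq hne hcpt hU hr hrR hb⟩
  have hv := hb r hr hrR
  have f1 : volume (parSet A r) ≠ ∞ := vol_le_ne hne hcpt r
  have f2 : volume A ≠ ∞ := hcpt.measure_lt_top.ne
  have hsub : A ⊆ parSet A r := fun x hx => by
    show infDist x A ≤ r
    rw [infDist_zero_of_mem hx]; exact hr.le
  have hmono := ENNReal.toReal_mono f1 (measure_mono hsub)
  have hv' : (volume (parSet A r)).toReal = (volume A).toReal + (b * r + Real.pi * r ^ 2) := by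
    have : (volume (parSet A r)).toReal = (volume A).toReal + b * r + Real.pi * r ^ 2 := hv
    rw [this]; ring
  have h0 : 0 ≤ b * r + Real.pi * r ^ 2 := by linarith
  rw [← ENNReal.ofReal_toReal f1, hv', ENNReal.ofReal_add ENNReal.toReal_nonneg h0, ENNReal.ofReal_toReal f2]
end

section
/- Suppose Ω ⊂ ℝ² is simply connected and has no necks of radius r > 0. Then reach(Ω^r) ≥ r, where Ω^r = {x ∈ Ω : dist(x, ∂Ω) ≥ r}. -/
open MeasureTheory Metric Set ENNReal

def HasNoNecks (Ω : Set (EuclideanSpace ℝ (Fin 2))) (r : ℝ) : Prop :=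
  ∀ x₀ x₁ : EuclideanSpace ℝ (Fin 2), Metric.ball x₀ r ⊆ Ω → Metric.ball x₁ r ⊆ Ω →
    ∃ γ : ℝ → EuclideanSpace ℝ (Fin 2), ContinuousOn γ (Set.Icc 0 1) ∧
      γ 0 = x₀ ∧ γ 1 = x₁ ∧ ∀ t ∈ Set.Icc (0:ℝ) 1, Metric.ball (γ t) r ⊆ Ω

/-- The inner parallel set `Ω^r = {x ∈ Ω : dist(x, ∂Ω) ≥ r}`. -/
def innerPar (Ω : Set (EuclideanSpace ℝ (Fin 2))) (r : ℝ) : Set (EuclideanSpace ℝ (Fin 2)) :=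
  {x ∈ Ω | r ≤ Metric.infDist x (frontier Ω)}

open unitInterval in
/-- Two continuous logarithms along two paths with the same endpoints have the same increment. -/
lemma log_increment_eq {X : Type*} [TopologicalSpace X] [SimplyConnectedSpace X]
    (f : C(X, ℂ)) (hf : ∀ x, f x ≠ 0) {a b : X} (p q : Path a b) (P Q : C(I, ℂ))
    (hP : ∀ s, Complex.exp (P s) = f (p s)) (hQ : ∀ s, Complex.exp (Q s) = f (q s)) :
    P 1 - P 0 = Q 1 - Q 0 := by
  let F : C(X, {z : ℂ // z ≠ 0}) := ⟨fun x => ⟨f x, hf x⟩, by fun_prop⟩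
  obtain ⟨H⟩ := SimplyConnectedSpace.paths_homotopic p q
  have cov := Complex.isCoveringMap_exp
  have hrel : (F.comp p.toContinuousMap).HomotopicRel (F.comp q.toContinuousMap) {0, 1} :=
    ⟨H.compContinuousMap F⟩
  have hp0 : (F.comp p.toContinuousMap) 0 =
      (⟨Complex.exp (P 0), Complex.exp_ne_zero _⟩ : {z : ℂ // z ≠ 0}) := by
    apply Subtype.ext
    exact (hP 0).symm
  have hq0 : (F.comp q.toContinuousMap) 0 =
      (⟨Complex.exp (P 0), Complex.exp_ne_zero _⟩ : {z : ℂ // z ≠ 0}) := by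
    apply Subtype.ext
    change f (q 0) = Complex.exp (P 0)
    rw [hP 0, p.source, q.source]
  have key := cov.liftPath_apply_one_eq_of_homotopicRel hrel (P 0) hp0 hq0
  have h1 : P = cov.liftPath (F.comp p.toContinuousMap) (P 0) hp0 :=
    (cov.eq_liftPath_iff' _).2 ⟨funext fun s => Subtype.ext (hP s), rfl⟩
  let Q' : C(I, ℂ) := ⟨fun s => Q s + (P 0 - Q 0), by fun_prop⟩
  have h2 : Q' = cov.liftPath (F.comp q.toContinuousMap) (P 0) hq0 := by
    refine (cov.eq_liftPath_iff' _).2 ⟨funext fun s => Subtype.ext ?_, ?_⟩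
    · change Complex.exp (Q s + (P 0 - Q 0)) = f (q s)
      rw [Complex.exp_add, Complex.exp_sub, hP 0, hQ 0, hQ s, p.source, q.source,
        div_self (hf a), mul_one]
    · change Q 0 + (P 0 - Q 0) = P 0
      ring
  rw [← h1, ← h2] at key
  change P 1 = Q 1 + (P 0 - Q 0) at key
  rw [key]; ring

lemma div_mem_slitPlane_of_norm {a b : ℂ} (hb : b ≠ 0) (h : ‖a - b‖ < ‖a‖ + ‖b‖) :
    a / b ∈ Complex.slitPlane := by
  rw [Complex.mem_slitPlane_iff_not_le_zero]
  intro hle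
  obtain ⟨h1, h2⟩ := Complex.le_def.1 hle
  have hq : a / b = ((a / b).re : ℂ) := Complex.ext rfl (by simpa using h2)
  have hab : a = ((a / b).re : ℂ) * b := by rw [← hq]; field_simp
  set l := (a / b).re
  simp only [Complex.zero_re] at h1
  have e1 : a - b = ((l - 1 : ℝ) : ℂ) * b := by rw [hab]; push_cast; ring
  have n1 : ‖a - b‖ = (1 - l) * ‖b‖ := by
    rw [e1, norm_mul, Complex.norm_real, Real.norm_eq_abs, abs_of_nonpos (by linarith)]; ring
  have n2 : ‖a‖ = (-l) * ‖b‖ := by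
    rw [hab, norm_mul, Complex.norm_real, Real.norm_eq_abs, abs_of_nonpos h1]
  rw [n1, n2] at h
  linarith

open unitInterval in
lemma winding_core {X : Type*} [TopologicalSpace X] [SimplyConnectedSpace X]
    (g : C(X, ℂ)) {a b : X} (p q : Path a b) (c r t : ℝ) (hc : 0 < c) (ht : 0 < t)
    (ha : g a = -c) (hb : g b = c) (w v : ℂ) (hw : 0 < w.im) (hv : v.im < 0)
    (hgw : ∀ x, g x ≠ w) (hgv : ∀ x, g x ≠ v) (hwn : ‖w‖ < r + t) (hvn : ‖v‖ < r + t)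
    (hp0 : ∀ s, t ≤ ‖g (p s)‖) (hpw : ∀ s, r ≤ ‖g (p s) - w‖) (hpv : ∀ s, r ≤ ‖g (p s) - v‖)
    (hq : ∀ s, (g (q s)).im = 0) : False := by
  have hw' : ∀ x, g x - w ≠ 0 := fun x => sub_ne_zero.2 (hgw x)
  have hv' : ∀ x, g x - v ≠ 0 := fun x => sub_ne_zero.2 (hgv x)
  have hp0' : ∀ s, g (p s) ≠ 0 := fun s h => by
    have := hp0 s
    rw [h, norm_zero] at this
    linarith
  have s1 : ∀ s, (g (p s) - w) / g (p s) ∈ Complex.slitPlane := fun s => by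
    refine div_mem_slitPlane_of_norm (hp0' s) ?_
    have e : g (p s) - w - g (p s) = -w := by ring
    rw [e, norm_neg]
    linarith [hp0 s, hpw s]
  have s2 : ∀ s, g (p s) / (g (p s) - v) ∈ Complex.slitPlane := fun s => by
    refine div_mem_slitPlane_of_norm (hv' _) ?_
    have e : g (p s) - (g (p s) - v) = v := by ring
    rw [e]
    linarith [hp0 s, hpv s]
  let f : C(X, ℂ) := ⟨fun x => (g x - w) / (g x - v),
    Continuous.div (by fun_prop) (by fun_prop) hv'⟩
  let P : C(I, ℂ) := ⟨fun s => Complex.log ((g (p s) - w) / g (p s)) +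
      Complex.log (g (p s) / (g (p s) - v)), by
    refine Continuous.add (Continuous.clog ?_ s1) (Continuous.clog ?_ s2)
    · exact Continuous.div (by fun_prop) (by fun_prop) hp0'
    · exact Continuous.div (by fun_prop) (by fun_prop) fun s => hv' _⟩
  let Q : C(I, ℂ) := ⟨fun s => Complex.log (g (q s) - w) - Complex.log (g (q s) - v), by
    refine Continuous.sub (Continuous.clog (by fun_prop) ?_) (Continuous.clog (by fun_prop) ?_)
    · intro s; right; simp [hq s]; linarith
    · intro s; right; simp [hq s]; linarith⟩
  have key := log_increment_eq f (fun x => div_ne_zero (hw' x) (hv' x)) p q P Q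
    (fun s => by
      change Complex.exp (_ + _) = (g (p s) - w) / (g (p s) - v)
      rw [Complex.exp_add, Complex.exp_log (div_ne_zero (hw' _) (hp0' s)),
        Complex.exp_log (div_ne_zero (hp0' s) (hv' _))]
      have := hp0' s
      have := hv' (p s)
      field_simp)
    (fun s => by
      change Complex.exp (_ - _) = (g (q s) - w) / (g (q s) - v)
      rw [Complex.exp_sub, Complex.exp_log (hw' _), Complex.exp_log (hv' _)])
  have kim := congrArg Complex.im key
  simp only [P, Q, ContinuousMap.coe_mk, p.source, p.target, q.source, q.target, ha, hb,
    Complex.sub_im, Complex.add_im, Complex.log_im] at kim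
  have hc' : (c : ℂ) ≠ 0 := by exact_mod_cast hc.ne'
  have a1 : (((c : ℂ) - w) / c).arg = ((c : ℂ) - w).arg := by
    have e : ((c : ℂ) - w) / c = ((c⁻¹ : ℝ) : ℂ) * ((c : ℂ) - w) := by
      push_cast; field_simp
    rw [e, Complex.arg_real_mul _ (inv_pos.2 hc)]
  have n2 : ((c : ℂ) - v).arg ≠ Real.pi := fun h => by
    have := (Complex.arg_eq_pi_iff.1 h).2
    simp at this; linarith
  have a2 : ((c : ℂ) / ((c : ℂ) - v)).arg = - ((c : ℂ) - v).arg := by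
    rw [div_eq_mul_inv, Complex.arg_real_mul _ hc, Complex.arg_inv, if_neg n2]
  have a3 : ((-(c : ℂ) - w) / -c).arg = (-(c : ℂ) - w).arg + Real.pi := by
    have e : (-(c : ℂ) - w) / -c = ((c⁻¹ : ℝ) : ℂ) * (-(-(c : ℂ) - w)) := by
      push_cast; field_simp
    rw [e, Complex.arg_real_mul _ (inv_pos.2 hc), Complex.arg_neg_eq_arg_add_pi_of_im_neg]
    simpa using hw
  have n4 : (-(c : ℂ) - v).arg ≠ Real.pi := fun h => by
    have := (Complex.arg_eq_pi_iff.1 h).2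
    simp at this; linarith
  have a4 : (-(c : ℂ) / (-(c : ℂ) - v)).arg = - (-(c : ℂ) - v).arg + Real.pi := by
    have e : -(c : ℂ) / (-(c : ℂ) - v) = (c : ℂ) * (-((-(c : ℂ) - v)⁻¹)) := by
      rw [div_eq_mul_inv]; ring
    rw [e, Complex.arg_real_mul _ hc, Complex.arg_neg_eq_arg_add_pi_of_im_neg, Complex.arg_inv,
      if_neg n4]
    rw [Complex.inv_im]
    have hne : (-(c : ℂ) - v) ≠ 0 := fun h => by
      have := congrArg Complex.im h
      simp at this; linarith
    have : 0 < Complex.normSq (-(c : ℂ) - v) := Complex.normSq_pos.2 hne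
    apply div_neg_of_neg_of_pos _ this
    simpa using hv
  rw [a1, a2, a3, a4] at kim
  linarith [Real.pi_pos]

lemma obstacle_im_pos {c r t : ℝ} (hc : 0 < c) (ht : 0 < t)
    (h : c ^ 2 + t ^ 2 ≤ 2 * t * r) (u v : ℝ) (h1 : u ^ 2 + (v - t) ^ 2 < r ^ 2)
    (h2 : r ^ 2 ≤ (u - c) ^ 2 + v ^ 2) (h3 : r ^ 2 ≤ (u + c) ^ 2 + v ^ 2) : 0 < v := by
  by_contra hv
  push Not at hv
  wlog hu : 0 ≤ u generalizing u
  · exact this (-u) (by nlinarith) (by nlinarith) (by nlinarith) (by linarith)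
  -- `w = -v` satisfies `2 w t < c² - t² - 2 c u`
  have k1 : 2 * (-v) * t < c ^ 2 - t ^ 2 - 2 * c * u := by nlinarith
  have k2 : 2 * (-v) * t < c ^ 2 - t ^ 2 := by nlinarith [mul_nonneg hc.le hu]
  have k0 : 0 ≤ 2 * (-v) * t := by nlinarith
  have hcu : 2 * u < c := by nlinarith
  have k3 : (2 * (-v) * t) ^ 2 < (c ^ 2 - t ^ 2) ^ 2 := by
    apply pow_lt_pow_left₀ k2 k0; norm_num
  have k4 : (c ^ 2 + t ^ 2) ^ 2 ≤ (2 * t * r) ^ 2 := by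
    apply pow_le_pow_left₀ (by positivity) h
  have k5 : (u - c) ^ 2 ≤ c ^ 2 := by nlinarith
  have k6 : 4 * t ^ 2 * r ^ 2 ≤ 4 * t ^ 2 * (c ^ 2 + v ^ 2) := by
    apply mul_le_mul_of_nonneg_left (by linarith) (by positivity)
  nlinarith

lemma exists_coord (y₀ y₁ : EuclideanSpace ℝ (Fin 2)) (c : ℝ) (hc : 0 < c)
    (hd : dist y₀ y₁ = 2 * c) :
    ∃ T : EuclideanSpace ℝ (Fin 2) ≃ᵢ ℂ, T y₀ = -c ∧ T y₁ = c := by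
  let φ := Complex.orthonormalBasisOneI.repr.symm
  have hn : ‖φ y₁ - φ y₀‖ = 2 * c := by
    rw [← map_sub, LinearIsometryEquiv.norm_map, ← dist_eq_norm, dist_comm, hd]
  have hne : φ y₁ - φ y₀ ≠ 0 := fun h => by
    rw [h, norm_zero] at hn; linarith
  have hc' : (c : ℂ) ≠ 0 := by exact_mod_cast hc.ne'
  let u : ℂ := 2 * c / (φ y₁ - φ y₀)
  have hu : ‖u‖ = 1 := by
    simp only [u, norm_div, norm_mul, hn, Complex.norm_real, Real.norm_eq_abs, abs_of_pos hc]
    simp [hc.ne']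
  let U : Circle := ⟨u, by simp [Submonoid.unitSphere, hu]⟩
  refine ⟨(φ.toIsometryEquiv.trans (IsometryEquiv.subRight ((φ y₀ + φ y₁) / 2))).trans
    (rotation U).toIsometryEquiv, ?_, ?_⟩
  · change u * (φ y₀ - (φ y₀ + φ y₁) / 2) = -c
    simp only [u]; field_simp; ring
  · change u * (φ y₁ - (φ y₀ + φ y₁) / 2) = c
    simp only [u]; field_simp; ring

open unitInterval in
lemma nearest_unique (Ω : Set (EuclideanSpace ℝ (Fin 2)))
    (r : ℝ) (hr : 0 < r) (hsc : SimplyConnectedSpace Ω) (hneck : HasNoNecks Ω r)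
    (x y₀ y₁ : EuclideanSpace ℝ (Fin 2)) (d : ℝ) (hdr : d < r) (h₀ : ball y₀ r ⊆ Ω)
    (h₁ : ball y₁ r ⊆ Ω) (hx₀ : dist x y₀ = d) (hx₁ : dist x y₁ = d)
    (hmin : ∀ y, ball y r ⊆ Ω → d ≤ dist x y) : y₀ = y₁ := by
  by_contra hne
  obtain ⟨c, hc, hcd⟩ : ∃ c : ℝ, 0 < c ∧ dist y₀ y₁ = 2 * c :=
    ⟨dist y₀ y₁ / 2, half_pos (dist_pos.2 hne), by ring⟩
  obtain ⟨T, hT₀, hT₁⟩ := exists_coord y₀ y₁ c hc hcd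
  obtain ⟨γ, hγc, hγ0, hγ1, hγ⟩ := hneck y₀ y₁ h₀ h₁
  have hd0 : 0 ≤ d := hx₀ ▸ dist_nonneg
  -- coordinates of `x`
  have e₀ : ((T x).re + c) ^ 2 + (T x).im ^ 2 = d ^ 2 := by
    rw [← hx₀, ← T.dist_eq, hT₀, Complex.dist_eq, Complex.sq_norm, Complex.normSq_apply]
    simp; ring
  have e₁ : ((T x).re - c) ^ 2 + (T x).im ^ 2 = d ^ 2 := by
    rw [← hx₁, ← T.dist_eq, hT₁, Complex.dist_eq, Complex.sq_norm, Complex.normSq_apply]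
    simp; ring
  have hre : (T x).re = 0 := by
    have : 4 * c * (T x).re = 0 := by linarith
    rcases mul_eq_zero.1 this with h | h
    · linarith
    · exact h
  set k := (T x).im with hk
  have hTx : T x = k * Complex.I := by
    apply Complex.ext <;> simp [hre, hk]
  rw [hre] at e₀
  have hck : c ^ 2 + k ^ 2 = d ^ 2 := by linarith
  have hdpos : 0 < d := by
    rcases hd0.lt_or_eq with h | h
    · exact h
    · rw [← h] at hck; nlinarith
  have hkd : |k| < d := abs_lt_of_sq_lt_sq (by nlinarith) hd0
  have hcle : c ≤ d := by nlinarith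
  -- the choice of `t`
  obtain ⟨t, ht, htk, htc⟩ : ∃ t : ℝ, 0 < t ∧ t + |k| < d ∧ c ^ 2 + t ^ 2 ≤ 2 * t * r := by
    have h0 : 0 < d - |k| := by linarith
    have hl : d / r < 1 := (div_lt_one hr).2 hdr
    have hl0 : 0 < d / r := by positivity
    have hlt : (d - |k|) * (d / r) < d - |k| := by nlinarith
    refine ⟨(d - |k|) * (d / r), by positivity, by linarith, ?_⟩
    have e : 2 * ((d - |k|) * (d / r)) * r = 2 * (d - |k|) * d := by field_simp
    rw [e]
    have : ((d - |k|) * (d / r)) ^ 2 ≤ (d - |k|) ^ 2 :=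
      pow_le_pow_left₀ (by positivity) hlt.le 2
    nlinarith [sq_abs k]
  -- distance from `x` of points close to the origin
  have hnear : ∀ p : ℂ, ‖p‖ ≤ t → dist (T x) p < d := by
    intro p hp
    rw [Complex.dist_eq]
    have : ‖T x‖ = |k| := by rw [hTx]; simp
    linarith [norm_sub_le (T x) p]
  have hobs : ∀ p : ℂ, ‖p‖ ≤ t → ∃ z, T.symm z ∉ Ω ∧ dist z p < r := by
    intro p hp
    by_contra! hcon
    have hb : ball (T.symm p) r ⊆ Ω := by
      intro q hq
      by_contra hqΩ
      have := hcon (T q) (by simpa using hqΩ)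
      rw [mem_ball, ← T.dist_eq, T.apply_symm_apply] at hq
      linarith
    have := hmin _ hb
    rw [← T.dist_eq, T.apply_symm_apply] at this
    linarith [hnear p hp]
  have hfar : ∀ z, T.symm z ∉ Ω → ∀ y, ball y r ⊆ Ω → r ≤ ‖T y - z‖ := by
    intro z hz y hy
    by_contra! h
    refine hz (hy ?_)
    rw [mem_ball, dist_comm, ← T.dist_eq, T.apply_symm_apply, Complex.dist_eq]
    exact h
  have hnormt : ‖(t : ℂ) * Complex.I‖ = t := by simp [abs_of_pos ht]
  have far0 : ∀ z, T.symm z ∉ Ω → r ^ 2 ≤ (z.re + c) ^ 2 + z.im ^ 2 := by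
    intro z hz
    have := pow_le_pow_left₀ hr.le (hfar z hz y₀ h₀) 2
    rw [hT₀, Complex.sq_norm, Complex.normSq_apply] at this
    simp at this; linarith
  have far1 : ∀ z, T.symm z ∉ Ω → r ^ 2 ≤ (z.re - c) ^ 2 + z.im ^ 2 := by
    intro z hz
    have := pow_le_pow_left₀ hr.le (hfar z hz y₁ h₁) 2
    rw [hT₁, Complex.sq_norm, Complex.normSq_apply] at this
    simp at this; linarith
  obtain ⟨w, hwΩ, hwt⟩ := hobs (t * Complex.I) hnormt.le
  obtain ⟨v, hvΩ, hvt⟩ := hobs (-(t * Complex.I)) (by rw [norm_neg]; exact hnormt.le)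
  rw [Complex.dist_eq] at hwt hvt
  have hwn : ‖w‖ < r + t := by
    have := norm_add_le (w - t * Complex.I) (t * Complex.I)
    rw [sub_add_cancel] at this
    linarith
  have hvn : ‖v‖ < r + t := by
    have := norm_add_le (v - -(t * Complex.I)) (-(t * Complex.I))
    rw [sub_add_cancel, norm_neg (_ * _)] at this
    linarith
  have hwim : 0 < w.im := by
    refine obstacle_im_pos hc ht htc w.re w.im ?_ (far1 w hwΩ) (far0 w hwΩ)
    have := pow_lt_pow_left₀ hwt (norm_nonneg _) two_ne_zero
    rw [Complex.sq_norm, Complex.normSq_apply] at this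
    simp at this; linarith
  have hvim : v.im < 0 := by
    have : 0 < -v.im := by
      refine obstacle_im_pos hc ht htc v.re (-v.im) ?_ (by have := far1 v hvΩ; linarith)
        (by have := far0 v hvΩ; linarith)
      have := pow_lt_pow_left₀ hvt (norm_nonneg _) two_ne_zero
      rw [Complex.sq_norm, Complex.normSq_apply] at this
      simp at this; linarith
    linarith
  -- the two paths
  have hmem : ∀ y, ball y r ⊆ Ω → y ∈ Ω := fun y hy => hy (mem_ball_self hr)
  let a : Ω := ⟨y₀, hmem _ h₀⟩
  let b : Ω := ⟨y₁, hmem _ h₁⟩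
  let p : Path a b :=
    { toFun := fun s => ⟨γ s, hmem _ (hγ s s.2)⟩
      continuous_toFun := by
        refine Continuous.subtype_mk ?_ _
        exact hγc.restrict
      source' := Subtype.ext (by simpa using hγ0)
      target' := Subtype.ext (by simpa using hγ1) }
  have hseg : ∀ s : I, T.symm (((2 * (s : ℝ) - 1) * c : ℝ) : ℂ) ∈ Ω := by
    intro s
    have hs0 := s.2.1
    have hs1 := s.2.2
    rcases le_total (s : ℝ) (1 / 2) with h | h
    · apply h₀
      rw [mem_ball, ← T.dist_eq, T.apply_symm_apply, hT₀, Complex.dist_eq, ← Complex.ofReal_neg,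
        ← Complex.ofReal_sub, Complex.norm_real, Real.norm_eq_abs, abs_lt]
      constructor <;> nlinarith
    · apply h₁
      rw [mem_ball, ← T.dist_eq, T.apply_symm_apply, hT₁, Complex.dist_eq,
        ← Complex.ofReal_sub, Complex.norm_real, Real.norm_eq_abs, abs_lt]
      constructor <;> nlinarith
  let q : Path a b :=
    { toFun := fun s => ⟨T.symm (((2 * (s : ℝ) - 1) * c : ℝ) : ℂ), hseg s⟩
      continuous_toFun := by
        refine Continuous.subtype_mk ?_ _
        exact T.symm.continuous.comp (by fun_prop)
      source' := Subtype.ext (by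
        change T.symm _ = y₀
        rw [T.symm_apply_eq, hT₀]; simp)
      target' := Subtype.ext (by
        change T.symm _ = y₁
        rw [T.symm_apply_eq, hT₁]; norm_num) }
  let g : C(Ω, ℂ) := ⟨fun y => T y, T.continuous.comp continuous_subtype_val⟩
  refine winding_core g p q c r t hc ht hT₀ hT₁ w v hwim hvim ?_ ?_ hwn hvn ?_ ?_ ?_ ?_
  · intro y hy
    apply hwΩ
    rw [← hy]
    change T.symm (T y) ∈ Ω
    rw [T.symm_apply_apply]; exact y.2
  · intro y hy
    apply hvΩ
    rw [← hy]
    change T.symm (T y) ∈ Ω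
    rw [T.symm_apply_apply]; exact y.2
  · intro s
    change t ≤ ‖T (γ s)‖
    by_contra! hlt
    have h1 := hnear _ hlt.le
    rw [T.dist_eq] at h1
    linarith [hmin _ (hγ s s.2)]
  · intro s
    exact hfar w hwΩ _ (hγ s s.2)
  · intro s
    exact hfar v hvΩ _ (hγ s s.2)
  · intro s
    change (T (T.symm _)).im = 0
    rw [T.apply_symm_apply]; exact Complex.ofReal_im _

lemma mem_innerPar_iff (Ω : Set (EuclideanSpace ℝ (Fin 2))) (r : ℝ) (hr : 0 < r)
    (hΩ : Ω ≠ univ) (y : EuclideanSpace ℝ (Fin 2)) : y ∈ innerPar Ω r ↔ ball y r ⊆ Ω := by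
  constructor
  · rintro ⟨hy, hd⟩
    by_contra hnot
    obtain ⟨q, hq, hqΩ⟩ := not_subset.1 hnot
    have hpre : IsPreconnected (ball y r) := (convex_ball y r).isPreconnected
    obtain ⟨z, hz, hzf⟩ : ∃ z ∈ ball y r, z ∈ frontier Ω := by
      by_contra! hno
      have hy' : y ∈ interior Ω := by
        by_contra h
        exact hno y (mem_ball_self hr) ⟨subset_closure hy, h⟩
      have hq' : q ∈ (closure Ω)ᶜ := fun h => hno q hq ⟨h, fun h' => hqΩ (interior_subset h')⟩
      obtain ⟨z, -, hz1, hz2⟩ := hpre (interior Ω) (closure Ω)ᶜ isOpen_interior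
        isClosed_closure.isOpen_compl (fun z hz => by
          by_contra h
          simp only [mem_union, mem_compl_iff, not_or, not_not] at h
          exact hno z hz ⟨h.2, h.1⟩) ⟨y, mem_ball_self hr, hy'⟩ ⟨q, hq, hq'⟩
      exact hz2 (interior_subset_closure hz1)
    have := infDist_le_dist_of_mem (x := y) hzf
    rw [mem_ball, dist_comm] at hz
    linarith
  · intro h
    have hy := h (mem_ball_self hr)
    refine ⟨hy, ?_⟩
    have hne : (frontier Ω).Nonempty := nonempty_frontier_iff.2 ⟨⟨y, hy⟩, hΩ⟩
    rw [le_infDist hne]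
    intro z hz
    by_contra! hlt
    have : z ∈ interior Ω := interior_maximal h isOpen_ball (by rwa [mem_ball, dist_comm])
    exact hz.2 this

theorem reach_inner_parallel_set_of_no_necks (Ω : Set (EuclideanSpace ℝ (Fin 2)))
    (r : ℝ) (hr : 0 < r) (hsc : SimplyConnectedSpace Ω) (hneck : HasNoNecks Ω r) :
    ENNReal.ofReal r ≤ reach (innerPar Ω r) := by
  refine le_of_forall_lt fun s hs => ?_
  obtain ⟨s', hss', hs'⟩ := exists_between hs
  refine hss'.trans_le (le_sSup ?_)
  intro x hx
  have hlt : infEDist x (innerPar Ω r) < ENNReal.ofReal r := lt_of_le_of_lt hx hs'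
  have hne : (innerPar Ω r).Nonempty := by
    rw [nonempty_iff_ne_empty]
    intro h
    rw [h] at hlt
    simp at hlt
  have hΩ : Ω ≠ univ := by
    rintro rfl
    obtain ⟨y, -, hy⟩ := hne
    simp at hy
    linarith
  have hiff := mem_innerPar_iff Ω r hr hΩ
  have hclosed : IsClosed (innerPar Ω r) := by
    have : innerPar Ω r = ⋂ z ∈ Ωᶜ, {y | r ≤ dist z y} := by
      ext y
      rw [hiff]
      simp only [mem_iInter, mem_setOf_eq, mem_compl_iff]
      constructor
      · intro h z hz
        by_contra! hl
        exact hz (h hl)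
      · intro h z hz
        by_contra hzΩ
        have := h z hzΩ
        rw [mem_ball] at hz
        linarith
    rw [this]
    refine isClosed_biInter fun z _ => isClosed_le continuous_const (by fun_prop)
  have hdr : infDist x (innerPar Ω r) < r := by
    rw [infDist]
    exact (ENNReal.lt_ofReal_iff_toReal_lt hlt.ne_top).1 hlt
  obtain ⟨y, hy, hxy⟩ := hclosed.exists_infDist_eq_dist hne x
  refine ⟨y, ⟨hy, hxy.symm⟩, ?_⟩
  rintro y' ⟨hy', hxy'⟩
  exact nearest_unique Ω r hr hsc hneck x y' y _ hdr ((hiff _).1 hy') ((hiff _).1 hy) hxy' hxy.symm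
    fun z hz => infDist_le_dist_of_mem ((hiff z).2 hz)
end
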